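/- arXiv:2506.12151 — 2 statements merged into one kernel-verified Lean document; each statement's English description precedes it below -/
import Mathlib

section
/- Let k > ℓ ≥ 1 be integers. If k ≤ 2ℓ−1, then C(C_{2k+1}, C_{2ℓ+1}) ≤ 2(k+1)/(2ℓ+1). If k ≥ 2ℓ, then C(C_{2k+1}, C_{2ℓ+1}) ≤ (2k(2k−2ℓ+1)−1)/(2ℓ(2k−2ℓ+1)−1). -/
open SimpleGraph

/-- The homomorphism density `t(G,T)`. -/
noncomputable def homDensity {α β : Type*} [Fintype α] [Fintype β]
    (G : SimpleGraph α) (T : SimpleGraph β) : ℝ :=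
  (Nat.card (G →g T) : ℝ) / (Fintype.card β : ℝ) ^ (Fintype.card α)
/-- The set of real exponents `c ≥ 0` such that `t(G,T) ≥ t(H,T)^c` for all
finite graphs `T` with at least one vertex. -/
def domSet {α β : Type*} [Fintype α] [Fintype β]
    (G : SimpleGraph α) (H : SimpleGraph β) : Set ℝ :=
  {c : ℝ | 0 ≤ c ∧ ∀ (n : ℕ), 0 < n → ∀ T : SimpleGraph (Fin n),
    homDensity H T ^ c ≤ homDensity G T}

/-- The homomorphism density domination exponent `C(G,H)`, as the infimum of `domSet G H`. -/
noncomputable def domExp {α β : Type*} [Fintype α] [Fintype β]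
    (G : SimpleGraph α) (H : SimpleGraph β) : ℝ :=
  sInf (domSet G H)

/-- Log-sum inequality. -/
theorem logsum {ι : Type*} (s : Finset ι) (a b : ι → ℝ) (ha : ∀ i ∈ s, 0 ≤ a i)
    (hb : ∀ i ∈ s, 0 ≤ b i) (hab : ∀ i ∈ s, a i ≠ 0 → 0 < b i) :
    ∑ i ∈ s, a i * (Real.log (b i) - Real.log (a i) + Real.log (∑ j ∈ s, a j))
      ≤ (∑ i ∈ s, a i) * Real.log (∑ i ∈ s, b i) := by
  rcases (Finset.sum_nonneg ha).eq_or_lt with h0 | hA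
  · have := (Finset.sum_eq_zero_iff_of_nonneg ha).1 h0.symm
    rw [← h0, Finset.sum_eq_zero (fun i hi => by rw [this i hi, zero_mul])]; simp
  · obtain ⟨i0, hi0, hne⟩ : ∃ i ∈ s, a i ≠ 0 := by
      by_contra! h
      exact hA.ne' (Finset.sum_eq_zero h)
    have hB : 0 < ∑ i ∈ s, b i :=
      (hab i0 hi0 hne).trans_le (Finset.single_le_sum hb hi0)
    set A := ∑ j ∈ s, a j with hAd
    set B := ∑ j ∈ s, b j with hBd
    have key : ∀ i ∈ s, a i * (Real.log (b i) - Real.log (a i) + Real.log A)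
        ≤ a i * Real.log B + (b i * (A / B) - a i) := by
      intro i hi
      by_cases h : a i = 0
      · rw [h]; have := hb i hi; simp; positivity
      · have hai : 0 < a i := lt_of_le_of_ne (ha i hi) (Ne.symm h)
        have hbi := hab i hi h
        have h1 := Real.log_le_sub_one_of_pos (x := b i * A / (a i * B)) (by positivity)
        rw [Real.log_div (by positivity) (by positivity), Real.log_mul (by positivity) (by positivity),
          Real.log_mul (by positivity) (by positivity)] at h1
        have h2 := mul_le_mul_of_nonneg_left h1 hai.le
        have h3 : a i * (b i * A / (a i * B) - 1) = b i * (A / B) - a i := by field_simp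
        rw [h3] at h2
        linarith
    refine (Finset.sum_le_sum key).trans (le_of_eq ?_)
    rw [Finset.sum_add_distrib, Finset.sum_sub_distrib, ← Finset.sum_mul, ← Finset.sum_mul,
      ← hAd, ← hBd]
    field_simp; ring

section
variable {V : Type*} [Fintype V] [DecidableEq V]

theorem pow_nonneg_entry (A : Matrix V V ℝ) (h0 : ∀ x y, 0 ≤ A x y) (r : ℕ) (x y : V) :
    0 ≤ (A ^ r) x y := by
  induction r generalizing x y with
  | zero => rw [pow_zero, Matrix.one_apply]; split_ifs <;> norm_num
  | succ r ih =>
    rw [pow_succ, Matrix.mul_apply]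
    exact Finset.sum_nonneg fun i _ => mul_nonneg (ih _ _) (h0 _ _)

theorem pow_symm_entry (A : Matrix V V ℝ) (hs : ∀ x y, A x y = A y x) (r : ℕ) (x y : V) :
    (A ^ r) x y = (A ^ r) y x := by
  have : A.transpose = A := by ext i j; exact hs j i
  conv_lhs => rw [← this, ← Matrix.transpose_pow]
  rfl

theorem pow_back (A : Matrix V V ℝ) (h0 : ∀ x y, 0 ≤ A x y) (hs : ∀ x y, A x y = A y x)
    (r : ℕ) (x z : V) (h : 0 < (A ^ (r+1)) x z) : 0 < (A ^ (r+3)) x z := by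
  have h' := h
  rw [pow_succ', Matrix.mul_apply] at h
  obtain ⟨y, -, hy⟩ := Finset.exists_ne_zero_of_sum_ne_zero h.ne'
  have hA : 0 < A x y := lt_of_le_of_ne (h0 _ _) (Ne.symm (left_ne_zero_of_mul hy))
  rw [pow_succ', Matrix.mul_apply]
  refine lt_of_lt_of_le ?_ (Finset.single_le_sum (f := fun j => A x j * (A ^ (r+2)) j z)
    (fun i _ => mul_nonneg (h0 _ _) (pow_nonneg_entry A h0 _ _ _)) (Finset.mem_univ y))
  refine mul_pos hA ?_
  rw [pow_succ', Matrix.mul_apply]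
  refine lt_of_lt_of_le ?_ (Finset.single_le_sum (f := fun j => A y j * (A ^ (r+1)) j z)
    (fun i _ => mul_nonneg (h0 _ _) (pow_nonneg_entry A h0 _ _ _)) (Finset.mem_univ x))
  exact mul_pos (hs x y ▸ hA) h'

theorem pow_back' (A : Matrix V V ℝ) (h0 : ∀ x y, 0 ≤ A x y) (hs : ∀ x y, A x y = A y x)
    (r j : ℕ) (x z : V) (h : 0 < (A ^ (r+1)) x z) : 0 < (A ^ (r+1+2*j)) x z := by
  induction j with
  | zero => exact h
  | succ j ih =>
    have := pow_back A h0 hs (r+2*j) x z (by rw [show r+2*j+1 = r+1+2*j by ring]; exact ih)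
    rwa [show r+1+2*(j+1) = r+2*j+3 by ring]

/-- One-step entropy lemma. -/
theorem one_step (A : Matrix V V ℝ) (h0 : ∀ x y, 0 ≤ A x y)
    (r : ℕ) (τ : V → V → V → ℝ) (hτ : ∀ y x z, 0 ≤ τ y x z)
    (hA : ∀ y x z, τ y x z ≠ 0 → A y x = 1)
    (hW : ∀ y x z, τ y x z ≠ 0 → 0 < (A ^ r) x z) :
    ∑ y, ∑ z, ∑ x, τ y x z * (Real.log ((A ^ r) x z) - Real.log (τ y x z)
        + Real.log (∑ x, τ y x z)) ≤
      ∑ y, ∑ z, (∑ x, τ y x z) * Real.log ((A ^ (r+1)) y z) := by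
  refine Finset.sum_le_sum fun y _ => Finset.sum_le_sum fun z _ => ?_
  have := logsum Finset.univ (fun x => τ y x z) (fun x => A y x * (A ^ r) x z)
    (fun i _ => hτ _ _ _) (fun i _ => mul_nonneg (h0 _ _) (pow_nonneg_entry A h0 _ _ _))
    (fun i _ h => by simp only [hA y i z h, one_mul]; exact hW _ _ _ h)
  rw [pow_succ', Matrix.mul_apply]
  refine le_trans (le_of_eq ?_) this
  refine Finset.sum_congr rfl fun x _ => ?_
  by_cases h : τ y x z = 0
  · simp [h]
  · simp [hA y x z h]

/-- The quantity `Ψ`. -/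
noncomputable def Psi (A : Matrix V V ℝ) (a b r : ℕ) : ℝ :=
  ∑ x, ∑ z, (A ^ a) x z * (A ^ b) x z * Real.log ((A ^ r) x z)

theorem Psi_comm (A : Matrix V V ℝ) (a b r : ℕ) : Psi A a b r = Psi A b a r := by
  unfold Psi; simp only [mul_comm ((A ^ a) _ _)]

theorem Psi_step (A : Matrix V V ℝ) (h01 : ∀ x y, A x y = 0 ∨ A x y = 1)
    (hs : ∀ x y, A x y = A y x) (a b r : ℕ)
    (hp : ∀ x z, (A ^ a) x z ≠ 0 → (A ^ (b+1)) x z ≠ 0 → 0 < (A ^ r) x z) :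
    Psi A a (b+1) r + Psi A (a+1) b (a+1) - Psi A a (b+1) a ≤ Psi A (a+1) b (r+1) := by
  have h0 : ∀ x y, 0 ≤ A x y := fun x y => by rcases h01 x y with h | h <;> simp [h]
  have hn := pow_nonneg_entry A h0
  have hsum : ∀ y z, ∑ x, A y x * (A ^ a) x z * (A ^ b) y z = (A ^ (a+1)) y z * (A ^ b) y z := by
    intro y z; rw [← Finset.sum_mul, pow_succ', Matrix.mul_apply]
  have hsum2 : ∀ x z, ∑ y, A y x * (A ^ a) x z * (A ^ b) y z = (A ^ a) x z * (A ^ (b+1)) x z := by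
    intro x z; rw [pow_succ', Matrix.mul_apply, Finset.mul_sum]
    refine Finset.sum_congr rfl fun y _ => ?_
    rw [hs x y]; ring
  have key := one_step A h0 r (fun y x z => A y x * (A ^ a) x z * (A ^ b) y z)
    (fun y x z => mul_nonneg (mul_nonneg (h0 _ _) (hn _ _ _)) (hn _ _ _))
    (fun y x z h => (h01 y x).resolve_left (left_ne_zero_of_mul (left_ne_zero_of_mul h)))
    (fun y x z h => hp x z (right_ne_zero_of_mul (left_ne_zero_of_mul h)) (by
      have h1 := left_ne_zero_of_mul (left_ne_zero_of_mul h)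
      have h2 := right_ne_zero_of_mul h
      rw [pow_succ', Matrix.mul_apply]
      refine (lt_of_lt_of_le ?_ (Finset.single_le_sum (f := fun j => A x j * (A ^ b) j z)
        (fun i _ => mul_nonneg (h0 _ _) (hn _ _ _)) (Finset.mem_univ y))).ne'
      refine mul_pos ?_ (lt_of_le_of_ne (hn _ _ _) (Ne.symm h2))
      rw [hs x y]; exact lt_of_le_of_ne (h0 _ _) (Ne.symm h1)))
  simp only [hsum] at key
  refine le_trans (le_of_eq ?_) key
  have e : ∀ y z x, A y x * (A ^ a) x z * (A ^ b) y z *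
      (Real.log ((A ^ r) x z) - Real.log (A y x * (A ^ a) x z * (A ^ b) y z)
        + Real.log ((A ^ (a+1)) y z * (A ^ b) y z)) =
      A y x * (A ^ a) x z * (A ^ b) y z * Real.log ((A ^ r) x z)
      + A y x * (A ^ a) x z * (A ^ b) y z * Real.log ((A ^ (a+1)) y z)
      - A y x * (A ^ a) x z * (A ^ b) y z * Real.log ((A ^ a) x z) := by
    intro y z x
    by_cases h : A y x * (A ^ a) x z * (A ^ b) y z = 0
    · rw [h]; ring
    · have h1 := (h01 y x).resolve_left (left_ne_zero_of_mul (left_ne_zero_of_mul h))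
      have h2 := right_ne_zero_of_mul (left_ne_zero_of_mul h)
      have h3 := right_ne_zero_of_mul h
      have h4 : (A ^ (a+1)) y z ≠ 0 := by
        rw [pow_succ', Matrix.mul_apply]
        refine (lt_of_lt_of_le ?_ (Finset.single_le_sum (f := fun j => A y j * (A ^ a) j z)
          (fun i _ => mul_nonneg (h0 _ _) (hn _ _ _)) (Finset.mem_univ x))).ne'
        exact mul_pos (h1 ▸ one_pos) (lt_of_le_of_ne (hn _ _ _) (Ne.symm h2))
      rw [h1, one_mul, Real.log_mul h2 h3, Real.log_mul h4 h3]; ring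
  simp only [e, Finset.sum_add_distrib, Finset.sum_sub_distrib]
  have c1 : ∀ s, ∑ y, ∑ z, ∑ x, A y x * (A ^ a) x z * (A ^ b) y z * Real.log ((A ^ s) x z)
      = Psi A a (b+1) s := by
    intro s
    unfold Psi
    rw [Finset.sum_comm]
    simp only [fun z => Finset.sum_comm (s := (Finset.univ : Finset V)) (t := Finset.univ)
      (f := fun y x => A y x * (A ^ a) x z * (A ^ b) y z * Real.log ((A ^ s) x z)),
      ← Finset.sum_mul, hsum2]
    rw [Finset.sum_comm]
  have c2 : ∑ y, ∑ z, ∑ x, A y x * (A ^ a) x z * (A ^ b) y z * Real.log ((A ^ (a+1)) y z)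
      = Psi A (a+1) b (a+1) := by
    unfold Psi
    simp only [← Finset.sum_mul, hsum]
  rw [c1, c1, c2]

theorem tr_eq (A : Matrix V V ℝ) (hs : ∀ x y, A x y = A y x) (a b : ℕ) :
    ∑ x, ∑ z, (A ^ a) x z * (A ^ b) x z = (A ^ (a+b)).trace := by
  rw [pow_add, Matrix.trace]
  simp only [Matrix.diag, Matrix.mul_apply]
  refine Finset.sum_congr rfl fun x _ => Finset.sum_congr rfl fun z _ => ?_
  rw [pow_symm_entry A hs b]

/-- Final Jensen step. -/
theorem final_jensen (A : Matrix V V ℝ) (h0 : ∀ x y, 0 ≤ A x y)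
    (hs : ∀ x y, A x y = A y x) (a b r : ℕ)
    (hp : ∀ x z, (A ^ b) x z ≠ 0 → 0 < (A ^ r) x z) :
    Psi A a b r - Psi A a b b + (A ^ (a+b)).trace * Real.log ((A ^ (a+b)).trace)
      ≤ (A ^ (a+b)).trace * Real.log ((A ^ (a+r)).trace) := by
  have hn := pow_nonneg_entry A h0
  have key := logsum (Finset.univ : Finset (V × V))
    (fun p => (A ^ a) p.1 p.2 * (A ^ b) p.1 p.2) (fun p => (A ^ a) p.1 p.2 * (A ^ r) p.1 p.2)
    (fun p _ => mul_nonneg (hn _ _ _) (hn _ _ _)) (fun p _ => mul_nonneg (hn _ _ _) (hn _ _ _))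
    (fun p _ h => mul_pos (lt_of_le_of_ne (hn _ _ _) (Ne.symm (left_ne_zero_of_mul h)))
      (hp _ _ (right_ne_zero_of_mul h)))
  simp only [Fintype.sum_prod_type, tr_eq A hs] at key
  refine le_trans (le_of_eq ?_) key
  unfold Psi
  rw [← tr_eq A hs a b]
  simp only [← Finset.sum_sub_distrib, Finset.sum_mul, ← Finset.sum_add_distrib]
  refine Finset.sum_congr rfl fun x _ => Finset.sum_congr rfl fun z _ => ?_
  by_cases h : (A ^ a) x z * (A ^ b) x z = 0
  · rw [h]; ring
  · have h1 := left_ne_zero_of_mul h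
    have h2 := right_ne_zero_of_mul h
    rw [Real.log_mul h1 h2, Real.log_mul h1 (hp _ _ h2).ne']; ring

/-- iterate: `a + b = 2l` with arcs `a`, `b+1`. -/
theorem Psi_chain (A : Matrix V V ℝ) (h01 : ∀ x y, A x y = 0 ∨ A x y = 1)
    (hs : ∀ x y, A x y = A y x) (a b j : ℕ) :
    Psi A (a+1) (b+2) (b+2) + j * (Psi A (a+2) (b+1) (a+2) - Psi A (a+1) (b+2) (a+1)
      + Psi A (a+1) (b+2) (b+2) - Psi A (a+2) (b+1) (b+1)) ≤ Psi A (a+1) (b+2) (b+2+2*j) := by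
  have h0 : ∀ x y, 0 ≤ A x y := fun x y => by rcases h01 x y with h | h <;> simp [h]
  have hn := pow_nonneg_entry A h0
  induction j with
  | zero => simp
  | succ j ih =>
    have s1 := Psi_step A h01 hs (a+1) (b+1) (b+2+2*j)
      (fun x z _ h => pow_back' A h0 hs (b+1) j x z (lt_of_le_of_ne (hn _ _ _) (Ne.symm h)))
    have s2 := Psi_step A h01 hs (b+1) (a+1) (b+2+2*j+1)
      (fun x z h _ => by
        have := pow_back' A h0 hs b (j+1) x z (lt_of_le_of_ne (hn _ _ _) (Ne.symm h))
        rwa [show b+2+2*j+1 = b+1+2*(j+1) by ring])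
    rw [Psi_comm A (b+1+1), Psi_comm A (b+1+1), Psi_comm A (b+1), Psi_comm A (b+1)] at s2
    push_cast
    rw [show b+2+2*(j+1) = b+2+2*j+1+1 by ring]
    norm_num only [add_assoc] at *
    linarith

theorem Psi_one (A : Matrix V V ℝ) (h01 : ∀ x y, A x y = 0 ∨ A x y = 1) (a b : ℕ) :
    Psi A a b 1 = 0 := by
  unfold Psi
  refine Finset.sum_eq_zero fun x _ => Finset.sum_eq_zero fun z _ => ?_
  rw [pow_one]
  rcases h01 x z with h | h <;> simp [h]

theorem boundA (A : Matrix V V ℝ) (h01 : ∀ x y, A x y = 0 ∨ A x y = 1)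
    (hs : ∀ x y, A x y = A y x) (l j : ℕ) (hl : 1 ≤ l) :
    (2*(l:ℝ)-1) * ((A ^ (2*l+1)).trace * Real.log ((A ^ (2*l+1)).trace))
      + 2 * j * Psi A 1 (2*l) (2*l) ≤
    (2*(l:ℝ)-1) * ((A ^ (2*l+1)).trace * Real.log ((A ^ (2*l+1+2*j)).trace)) := by
  have h0 : ∀ x y, 0 ≤ A x y := fun x y => by rcases h01 x y with h | h <;> simp [h]
  have hn := pow_nonneg_entry A h0
  obtain ⟨M, rfl⟩ : ∃ M, l = M + 1 := ⟨l-1, by omega⟩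
  set e : ℕ → ℝ := fun i => Psi A (i+1) (2*M+2-i) (i+1) with he
  have main : ∀ i ∈ Finset.range (2*M+1),
      (A ^ (2*M+3)).trace * Real.log ((A ^ (2*M+3)).trace)
       + j * ((e (i+1) - e i) + (e (2*M+1-1-i+1) - e (2*M+1-1-i)))
       ≤ (A ^ (2*M+3)).trace * Real.log ((A ^ (2*M+3+2*j)).trace) := by
    intro i hi
    rw [Finset.mem_range] at hi
    obtain ⟨b, hb⟩ : ∃ b, 2*M = i + b := ⟨2*M-i, by omega⟩
    have h1 := Psi_chain A h01 hs i b j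
    have h2 := final_jensen A h0 hs (i+1) (b+2) (b+2+2*j) (fun x z h =>
      pow_back' A h0 hs (b+1) j x z (lt_of_le_of_ne (hn _ _ _) (Ne.symm h)))
    rw [show i+1+(b+2) = 2*M+3 by omega, show i+1+(b+2+2*j) = 2*M+3+2*j by omega] at h2
    have e1 : e (i+1) = Psi A (i+2) (b+1) (i+2) := by
      simp only [he]; rw [show 2*M+2-(i+1) = b+1 by omega]
    have e2 : e i = Psi A (i+1) (b+2) (i+1) := by
      simp only [he]; rw [show 2*M+2-i = b+2 by omega]
    have e3 : e (2*M+1-1-i+1) = Psi A (i+1) (b+2) (b+2) := by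
      rw [Psi_comm]
      simp only [he]; rw [show 2*M+1-1-i+1+1 = b+2 by omega, show 2*M+2-(2*M+1-1-i+1) = i+1 by omega]
    have e4 : e (2*M+1-1-i) = Psi A (i+2) (b+1) (b+1) := by
      rw [Psi_comm]
      simp only [he]; rw [show 2*M+1-1-i+1 = b+1 by omega, show 2*M+2-(2*M+1-1-i) = i+2 by omega]
    rw [e1, e2, e3, e4]
    linarith
  have hsum := Finset.sum_le_sum main
  rw [Finset.sum_add_distrib, ← Finset.mul_sum (f := fun i => (e (i+1) - e i) +
      (e (2*M+1-1-i+1) - e (2*M+1-1-i))), Finset.sum_add_distrib (f := fun i => e (i+1) - e i),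
    Finset.sum_range_reflect (fun i => e (i+1) - e i), Finset.sum_range_sub e] at hsum
  simp only [Finset.sum_const, Finset.card_range, nsmul_eq_mul] at hsum
  have e0 : e 0 = 0 := Psi_one A h01 _ _
  have e5 : e (2*M+1) = Psi A 1 (2*(M+1)) (2*(M+1)) := by
    simp only [he]; rw [show 2*M+2-(2*M+1) = 1 by omega, Psi_comm]; rfl
  rw [e0, e5] at hsum
  rw [show 2*(M+1)+1 = 2*M+3 by ring]
  push_cast at *
  linarith

/-- Markov chain pair laws. -/
noncomputable def rho (K π : V → V → ℝ) : ℕ → V → V → ℝ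
  | 0 => π
  | i+1 => fun w x => ∑ u, rho K π i u x * K u w

theorem boundB_core (A : Matrix V V ℝ) (h01 : ∀ x y, A x y = 0 ∨ A x y = 1)
    (hs : ∀ x y, A x y = A y x) (π : V → V → ℝ) (hπ0 : ∀ x y, 0 ≤ π x y)
    (hπs : ∀ x y, π x y = π y x) (hπ1 : ∑ x, ∑ y, π x y = 1)
    (hπA : ∀ x y, π x y ≠ 0 → A x y = 1) (p : ℕ) :
    (2*(p:ℝ)+1) * (- ∑ x, ∑ y, π x y * Real.log (π x y))
      - (2*p+2) * Real.log (Fintype.card V)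
      ≤ ∑ x, ∑ y, π x y * Real.log ((A ^ (2*p+1)) x y) := by
  have h0 : ∀ x y, 0 ≤ A x y := fun x y => by rcases h01 x y with h | h <;> simp [h]
  have hn := pow_nonneg_entry A h0
  set d : V → ℝ := fun x => ∑ y, π x y with hd
  have hd0 : ∀ x, 0 ≤ d x := fun x => Finset.sum_nonneg fun y _ => hπ0 x y
  have hπd : ∀ x y, π x y ≠ 0 → d x ≠ 0 := fun x y h h' =>
    h ((Finset.sum_eq_zero_iff_of_nonneg (fun y _ => hπ0 x y)).1 h' y (Finset.mem_univ y))
  set K : V → V → ℝ := fun x y => π x y / d x with hK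
  have hK0 : ∀ x y, 0 ≤ K x y := fun x y => div_nonneg (hπ0 _ _) (hd0 _)
  have hKA : ∀ x y, K x y ≠ 0 → A x y = 1 := fun x y h => hπA x y (fun h' => h (by simp [hK, h']))
  have hdK : ∀ x y, d x * K x y = π x y := by
    intro x y
    by_cases h : d x = 0
    · have : π x y = 0 := by by_contra h'; exact hπd x y h' h
      simp [h, this]
    · simp only [hK]; field_simp
  have hK1 : ∀ x, d x ≠ 0 → ∑ y, K x y = 1 := by
    intro x h; simp only [hK]; rw [← Finset.sum_div]; exact div_self h
  set R := rho K π with hR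
  have hRs : ∀ i w x, R (i+1) w x = ∑ u, R i u x * K u w := fun i w x => rfl
  have hR0 : ∀ i w x, 0 ≤ R i w x := by
    intro i; induction i with
    | zero => exact hπ0
    | succ i ih => intro w x; rw [hRs]; exact Finset.sum_nonneg fun u _ => mul_nonneg (ih _ _) (hK0 _ _)
  have hRd : ∀ i w, ∑ x, R i w x = d w := by
    intro i; induction i with
    | zero => intro w; rfl
    | succ i ih =>
      intro w
      simp only [hRs]
      rw [Finset.sum_comm]
      simp only [← Finset.sum_mul, ih, hdK]
      simp only [fun u => hπs u w]; rfl
  have hRdn : ∀ i w x, R i w x ≠ 0 → d w ≠ 0 := fun i w x h h' =>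
    h ((Finset.sum_eq_zero_iff_of_nonneg (fun y _ => hR0 i w y)).1 ((hRd i w).trans h') x
      (Finset.mem_univ x))
  have hR1 : ∀ i, ∑ w, ∑ x, R i w x = 1 := by
    intro i; simp only [hRd]; exact hπ1
  have hRW : ∀ i w x, R i w x ≠ 0 → 0 < (A ^ (i+1)) w x := by
    intro i; induction i with
    | zero => intro w x h; simp only [zero_add, pow_one]; rw [hπA w x h]; exact one_pos
    | succ i ih =>
      intro w x h
      rw [hRs] at h
      obtain ⟨u, -, hu⟩ := Finset.exists_ne_zero_of_sum_ne_zero h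
      rw [pow_succ', Matrix.mul_apply]
      refine (lt_of_lt_of_le ?_ (Finset.single_le_sum (f := fun j => A w j * (A ^ (i+1)) j x)
        (fun i _ => mul_nonneg (h0 _ _) (hn _ _ _)) (Finset.mem_univ u)))
      refine mul_pos ?_ (ih _ _ (left_ne_zero_of_mul hu))
      rw [hs w u, hKA u w (right_ne_zero_of_mul hu)]; exact one_pos
  set κ : ℝ := - ∑ x, ∑ y, π x y * Real.log (K x y) with hκ
  -- the kernel average
  have hav : ∀ i, ∑ u, ∑ x, ∑ w, R i u x * K u w * Real.log (K u w) = -κ := by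
    intro i
    rw [hκ, neg_neg]
    refine Finset.sum_congr rfl fun u _ => ?_
    rw [Finset.sum_comm]
    refine Finset.sum_congr rfl fun w _ => ?_
    rw [← Finset.sum_mul, ← Finset.sum_mul, hRd, hdK]
  have stage1 : ∀ i r, (∀ w x, R (i+1) w x ≠ 0 → 0 < (A ^ r) w x) →
      ∑ w, ∑ x, R (i+1) w x * Real.log ((A ^ r) w x) + κ
        ≤ ∑ w, ∑ x, R i w x * Real.log ((A ^ (r+1)) w x) := by
    intro i r hr
    have key := one_step A h0 r (fun y x z => R i y z * K y x)
      (fun y x z => mul_nonneg (hR0 _ _ _) (hK0 _ _))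
      (fun y x z h => hKA y x (right_ne_zero_of_mul h))
      (fun y x z h => hr x z (by
        rw [hRs]
        refine (lt_of_lt_of_le ?_ (Finset.single_le_sum (f := fun u => R i u z * K u x)
          (fun i _ => mul_nonneg (hR0 _ _ _) (hK0 _ _)) (Finset.mem_univ y))).ne'
        exact lt_of_le_of_ne (mul_nonneg (hR0 _ _ _) (hK0 _ _)) (Ne.symm h)))
    have hsum : ∀ y z, ∑ x, R i y z * K y x = R i y z := by
      intro y z
      by_cases h : R i y z = 0
      · simp [h]
      · rw [← Finset.mul_sum, hK1 y (hRdn _ _ _ h), mul_one]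
    simp only [hsum] at key
    refine le_trans (le_of_eq ?_) key
    have e : ∀ y z x, R i y z * K y x *
        (Real.log ((A ^ r) x z) - Real.log (R i y z * K y x) + Real.log (R i y z))
        = R i y z * K y x * Real.log ((A ^ r) x z) - R i y z * K y x * Real.log (K y x) := by
      intro y z x
      by_cases h : R i y z * K y x = 0
      · rw [h]; ring
      · rw [Real.log_mul (left_ne_zero_of_mul h) (right_ne_zero_of_mul h)]; ring
    simp only [e, Finset.sum_sub_distrib, hav, sub_neg_eq_add]
    congr 1
    have : ∑ y, ∑ z, ∑ x, R i y z * K y x * Real.log ((A ^ r) x z)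
      = ∑ z, ∑ x, ∑ y, R i y z * K y x * Real.log ((A ^ r) x z) := by
      rw [Finset.sum_comm]
      exact Finset.sum_congr rfl fun z _ => Finset.sum_comm
    rw [this, Finset.sum_comm]
    simp only [hRs, Finset.sum_mul]
  have stage2 : ∀ i, ∑ w, ∑ x, R i w x * (Real.log ((A ^ (i+1)) w x) - Real.log (R i w x)) + κ
      ≤ ∑ w, ∑ x, R (i+1) w x * (Real.log ((A ^ (i+2)) w x) - Real.log (R (i+1) w x)) := by
    intro i
    have key := one_step A h0 (i+1) (fun y x z => R i x z * K x y)
      (fun y x z => mul_nonneg (hR0 _ _ _) (hK0 _ _))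
      (fun y x z h => by rw [hs]; exact hKA x y (right_ne_zero_of_mul h))
      (fun y x z h => hRW i x z (left_ne_zero_of_mul h))
    simp only [← hRs] at key
    have e : ∀ y z x, R i x z * K x y *
        (Real.log ((A ^ (i+1)) x z) - Real.log (R i x z * K x y) + Real.log (R (i+1) y z))
        = R i x z * K x y * (Real.log ((A ^ (i+1)) x z) - Real.log (R i x z))
          - R i x z * K x y * Real.log (K x y) + R i x z * K x y * Real.log (R (i+1) y z) := by
      intro y z x
      by_cases h : R i x z * K x y = 0
      · rw [h]; ring
      · rw [Real.log_mul (left_ne_zero_of_mul h) (right_ne_zero_of_mul h)]; ring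
    simp only [e, Finset.sum_sub_distrib, Finset.sum_add_distrib] at key
    have f1 : ∑ y, ∑ z, ∑ x, R i x z * K x y * Real.log (R (i+1) y z)
        = ∑ w, ∑ x, R (i+1) w x * Real.log (R (i+1) w x) := by
      simp only [← Finset.sum_mul, ← hRs]
    have swap : ∀ f : V → V → V → ℝ, ∑ y, ∑ z, ∑ x, f y z x = ∑ x, ∑ z, ∑ y, f y z x := by
      intro f
      calc ∑ y, ∑ z, ∑ x, f y z x = ∑ y, ∑ x, ∑ z, f y z x :=
            Finset.sum_congr rfl fun y _ => Finset.sum_comm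
        _ = ∑ x, ∑ y, ∑ z, f y z x := Finset.sum_comm
        _ = _ := Finset.sum_congr rfl fun y _ => Finset.sum_comm
    have f2 : ∑ y, ∑ z, ∑ x, R i x z * K x y * Real.log (K x y) = -κ := by
      rw [swap, hav i]
    have f3 : ∑ y, ∑ z, ∑ x, R i x z * K x y * (Real.log ((A ^ (i+1)) x z) - Real.log (R i x z))
        = ∑ w, ∑ x, R i w x * (Real.log ((A ^ (i+1)) w x) - Real.log (R i w x)) := by
      rw [swap]
      refine Finset.sum_congr rfl fun x _ => Finset.sum_congr rfl fun z _ => ?_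
      rw [← Finset.sum_mul, ← Finset.mul_sum]
      by_cases h : R i x z = 0
      · simp [h]
      · rw [hK1 x (hRdn _ _ _ h), mul_one]
    rw [f1, f2, f3] at key
    simp only [mul_sub (R (i+1) _ _), Finset.sum_sub_distrib]
    linarith
  have it1 : ∀ i, i ≤ p → ∑ w, ∑ x, R i w x * Real.log ((A ^ (2*p+1-i)) w x) + i * κ
        ≤ ∑ w, ∑ x, π w x * Real.log ((A ^ (2*p+1)) w x) := by
    intro i
    induction i with
    | zero => intro _; simp [hR, rho]
    | succ i ih =>
      intro hi
      have h1 := ih (by omega)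
      have h2 := stage1 i (2*p+1-(i+1)) (fun w x h => by
        have := pow_back' A h0 hs (i+1) (p-(i+1)) w x (hRW _ _ _ h)
        rwa [show 2*p+1-(i+1) = i+1+1+2*(p-(i+1)) by omega])
      rw [show 2*p+1-(i+1)+1 = 2*p+1-i by omega] at h2
      rw [Nat.cast_add, Nat.cast_one]
      linarith
  have it2 : ∀ i : ℕ, (- ∑ x, ∑ y, π x y * Real.log (π x y)) + i * κ ≤
      ∑ w, ∑ x, R i w x * (Real.log ((A ^ (i+1)) w x) - Real.log (R i w x)) := by
    intro i
    induction i with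
    | zero =>
      simp only [Nat.cast_zero, zero_mul, add_zero, zero_add, pow_one]
      rw [← Finset.sum_neg_distrib]
      refine le_of_eq (Finset.sum_congr rfl fun x _ => ?_)
      rw [← Finset.sum_neg_distrib]
      refine (Finset.sum_congr rfl fun y _ => ?_)
      show _ = π x y * (Real.log (A x y) - Real.log (π x y))
      rcases h01 x y with h | h <;> simp [h]
    | succ i ih =>
      have := stage2 i
      push_cast
      rw [show i+1+1 = i+2 by ring]
      linarith
  have ent2 : - ∑ w, ∑ x, R p w x * Real.log (R p w x) ≤ 2 * Real.log (Fintype.card V) := by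
    have := logsum (Finset.univ : Finset (V × V)) (fun q => R p q.1 q.2) (fun _ => 1)
      (fun _ _ => hR0 _ _ _) (fun _ _ => zero_le_one) (fun _ _ _ => one_pos)
    simp only [Fintype.sum_prod_type, hR1] at this
    simp only [Real.log_one, zero_sub, add_zero, mul_neg, Finset.sum_neg_distrib,
      Finset.sum_const, Finset.card_univ, nsmul_eq_mul, mul_one, one_mul] at this
    rwa [← pow_two, Real.log_pow] at this
  have ent1 : - ∑ w, d w * Real.log (d w) ≤ Real.log (Fintype.card V) := by
    have := logsum (Finset.univ : Finset V) d (fun _ => 1)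
      (fun _ _ => hd0 _) (fun _ _ => zero_le_one) (fun _ _ _ => one_pos)
    have h1 : ∑ w, d w = 1 := hπ1
    simp only [h1] at this
    simpa using this
  have hκ2 : κ = (- ∑ x, ∑ y, π x y * Real.log (π x y)) + ∑ w, d w * Real.log (d w) := by
    have : ∀ x y, π x y * Real.log (K x y) = π x y * Real.log (π x y) - π x y * Real.log (d x) := by
      intro x y
      by_cases h : π x y = 0
      · simp [h]
      · simp only [hK]; rw [Real.log_div h (hπd x y h)]; ring
    rw [hκ]
    simp only [this, Finset.sum_sub_distrib, ← Finset.sum_mul]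
    ring
  have a1 := it1 p le_rfl
  have a2 := it2 p
  rw [show 2*p+1-p = p+1 by omega] at a1
  simp only [mul_sub, Finset.sum_sub_distrib] at a2
  set H := - ∑ x, ∑ y, π x y * Real.log (π x y)
  have : (p:ℝ) * (H - Real.log (Fintype.card V)) ≤ p * κ :=
    mul_le_mul_of_nonneg_left (by linarith) (Nat.cast_nonneg p)
  linarith

theorem boundB (A : Matrix V V ℝ) (h01 : ∀ x y, A x y = 0 ∨ A x y = 1)
    (hs : ∀ x y, A x y = A y x) (l p : ℕ) (hN : 0 < (A ^ (2*l+1)).trace) :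
    (A ^ (2*l+1)).trace * Real.log ((A ^ (2*l+1)).trace)
      + (2*(p:ℝ)+1) * ((A ^ (2*l+1)).trace * Real.log ((A ^ (2*l+1)).trace)
          - Psi A 1 (2*l) (2*l))
      - (2*p+2) * ((A ^ (2*l+1)).trace * Real.log (Fintype.card V)) ≤
    (A ^ (2*l+1)).trace * Real.log ((A ^ (2*l+1+2*p)).trace) := by
  have h0 : ∀ x y, 0 ≤ A x y := fun x y => by rcases h01 x y with h | h <;> simp [h]
  have hn := pow_nonneg_entry A h0
  have hNe : ∑ x, ∑ z, A x z * (A ^ (2*l)) x z = (A ^ (2*l+1)).trace := by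
    have := tr_eq A hs 1 (2*l)
    rwa [pow_one, add_comm] at this
  set N := (A ^ (2*l+1)).trace with hNd
  have hB := boundB_core A h01 hs (fun x y => A x y * (A ^ (2*l)) x y / N)
    (fun x y => div_nonneg (mul_nonneg (h0 _ _) (hn _ _ _)) hN.le)
    (fun x y => by rw [hs x y, pow_symm_entry A hs _ x y])
    (by simp only [← Finset.sum_div]; rw [hNe]; exact div_self hN.ne')
    (fun x y h => (h01 x y).resolve_left (fun h' => h (by simp [h']))) p
  have e1 : ∑ x, ∑ y, A x y * (A ^ (2*l)) x y / N * Real.log ((A ^ (2*p+1)) x y)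
      = Psi A 1 (2*l) (2*p+1) / N := by
    unfold Psi
    simp only [Finset.sum_div, pow_one]
    refine Finset.sum_congr rfl fun x _ => Finset.sum_congr rfl fun y _ => ?_
    ring
  have e2 : - ∑ x, ∑ y, A x y * (A ^ (2*l)) x y / N * Real.log (A x y * (A ^ (2*l)) x y / N)
      = Real.log N - Psi A 1 (2*l) (2*l) / N := by
    have : Real.log N = ∑ x, ∑ y, A x y * (A ^ (2*l)) x y / N * Real.log N := by
      simp only [← Finset.sum_mul, ← Finset.sum_div, hNe]
      rw [div_self hN.ne', one_mul]
    rw [this]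
    unfold Psi
    simp only [Finset.sum_div, pow_one, ← Finset.sum_neg_distrib, ← Finset.sum_sub_distrib]
    refine Finset.sum_congr rfl fun x _ => Finset.sum_congr rfl fun y _ => ?_
    rcases h01 x y with h | h
    · simp [h]
    · rw [h, one_mul]
      by_cases h' : (A ^ (2*l)) x y = 0
      · simp [h']
      · rw [Real.log_div h' hN.ne']; ring
  rw [e1, e2] at hB
  have hj := final_jensen A h0 hs (2*l) 1 (2*p+1) (fun x z h => by
    have := pow_back' A h0 hs 0 p x z (lt_of_le_of_ne (hn _ _ _) (Ne.symm h))
    rwa [show 2*p+1 = 0+1+2*p by ring])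
  rw [Psi_one A h01, Psi_comm, ← hNd, show 2*l+(2*p+1) = 2*l+1+2*p by ring] at hj
  have := mul_le_mul_of_nonneg_left hB hN.le
  rw [mul_div_cancel₀ _ hN.ne'] at this
  have h3 : N * ((2*(p:ℝ)+1) * (Real.log N - Psi A 1 (2*l) (2*l) / N)
      - (2*p+2) * Real.log (Fintype.card V)) = (2*(p:ℝ)+1) * (N * Real.log N - Psi A 1 (2*l) (2*l))
      - (2*p+2) * (N * Real.log (Fintype.card V)) := by
    field_simp
  rw [h3] at this
  linarith

theorem combined (A : Matrix V V ℝ) (h01 : ∀ x y, A x y = 0 ∨ A x y = 1)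
    (hs : ∀ x y, A x y = A y x) (l p : ℕ) (hl : 1 ≤ l) (hN : 0 < (A ^ (2*l+1)).trace) :
    (2*((l:ℝ)+p)*(2*p+1)-1) * Real.log ((A ^ (2*l+1)).trace)
      - (2*p)*(2*p+2) * Real.log (Fintype.card V)
     ≤ (2*(l:ℝ)*(2*p+1)-1) * Real.log ((A ^ (2*l+1+2*p)).trace) := by
  have ha := boundA A h01 hs l p hl
  have hb := boundB A h01 hs l p hN
  set N := (A ^ (2*l+1)).trace
  refine le_of_mul_le_mul_left ?_ hN
  have h1 := mul_le_mul_of_nonneg_left ha (show (0:ℝ) ≤ 2*p+1 by positivity)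
  have h2 := mul_le_mul_of_nonneg_left hb (show (0:ℝ) ≤ 2*p by positivity)
  linarith
end
theorem path_sum {V : Type*} [Fintype V] [DecidableEq V] (A : Matrix V V ℝ) (r : ℕ)
    (g : V → V → ℝ) :
    ∑ f : Fin (r+1) → V, (∏ i : Fin r, A (f i.castSucc) (f i.succ)) * g (f 0) (f (Fin.last r))
      = ∑ x, ∑ y, (A ^ r) x y * g x y := by
  induction r generalizing g with
  | zero =>
    rw [← (Equiv.funUnique (Fin 1) V).symm.sum_comp]
    simp [Matrix.one_apply]
  | succ r ih =>
    rw [← (Fin.consEquiv (fun _ : Fin (r+2) => V)).sum_comp, Fintype.sum_prod_type]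
    have h : ∀ (x : V) (f : Fin (r+1) → V),
        (∏ i : Fin (r+1), A ((Fin.consEquiv (fun _ : Fin (r+2) => V)) (x, f) i.castSucc)
          ((Fin.consEquiv (fun _ : Fin (r+2) => V)) (x, f) i.succ)) *
          g ((Fin.consEquiv (fun _ : Fin (r+2) => V)) (x, f) 0)
            ((Fin.consEquiv (fun _ : Fin (r+2) => V)) (x, f) (Fin.last (r+1))) =
        (∏ i : Fin r, A (f i.castSucc) (f i.succ)) * (A x (f 0) * g x (f (Fin.last r))) := by
      intro x f
      rw [Fin.prod_univ_succ]
      simp only [Fin.consEquiv_apply, ← Fin.succ_castSucc, Fin.cons_succ, ← Fin.succ_last,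
        Fin.cons_zero, Fin.castSucc_zero]
      ring
    simp only [h]
    simp only [fun x => ih (fun u v => A x u * g x v)]
    refine Finset.sum_congr rfl fun x _ => ?_
    rw [Finset.sum_comm]
    refine Finset.sum_congr rfl fun y _ => ?_
    rw [pow_succ', Matrix.mul_apply, Finset.sum_mul]
    refine Finset.sum_congr rfl fun z _ => ?_
    ring

theorem hom_cycle {V : Type*} [Fintype V] [DecidableEq V] (T : SimpleGraph V)
    [DecidableRel T.Adj] (r : ℕ) :
    (Nat.card (cycleGraph (r+2) →g T) : ℝ) = ((T.adjMatrix ℝ) ^ (r+2)).trace := by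
  have hadj : ∀ f : Fin (r+2) → V, (∀ {a b}, (cycleGraph (r+2)).Adj a b → T.Adj (f a) (f b)) ↔
      ((∀ i : Fin (r+1), T.Adj (f i.castSucc) (f i.succ)) ∧ T.Adj (f (Fin.last (r+1))) (f 0)) := by
    intro f
    constructor
    · intro h
      refine ⟨fun i => h ?_, h ?_⟩
      · rw [cycleGraph_adj]; right; rw [sub_eq_iff_eq_add, add_comm (1 : Fin (r+2))]; exact (Fin.coeSucc_eq_succ).symm
      · rw [cycleGraph_adj]; right; rw [sub_eq_iff_eq_add, add_comm (1 : Fin (r+2))]; exact (Fin.last_add_one _).symm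
    · rintro ⟨h1, h2⟩
      have key : ∀ a, T.Adj (f a) (f (a+1)) := by
        intro a
        induction a using Fin.lastCases with
        | last => rw [Fin.last_add_one]; exact h2
        | cast i => rw [Fin.coeSucc_eq_succ]; exact h1 i
      intro a b hab
      rw [cycleGraph_adj] at hab
      rcases hab with h | h
      · rw [sub_eq_iff_eq_add, add_comm (1 : Fin (r+2))] at h; rw [h]; exact (key b).symm
      · rw [sub_eq_iff_eq_add, add_comm (1 : Fin (r+2))] at h; rw [h]; exact key a
  let e : (cycleGraph (r+2) →g T) ≃ {f : Fin (r+2) → V //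
      ((∀ i : Fin (r+1), T.Adj (f i.castSucc) (f i.succ)) ∧ T.Adj (f (Fin.last (r+1))) (f 0))} :=
    { toFun := fun φ => ⟨φ, (hadj φ).1 (fun h => φ.map_adj h)⟩
      invFun := fun f => ⟨f.1, (hadj f.1).2 f.2⟩
      left_inv := fun φ => by ext; rfl
      right_inv := fun f => by ext; rfl }
  rw [Nat.card_congr e, Nat.card_eq_fintype_card, Fintype.card_subtype, Finset.card_filter]
  push_cast
  have hp := path_sum (T.adjMatrix ℝ) (r+1) (fun x y => T.adjMatrix ℝ y x)
  have ht : ((T.adjMatrix ℝ) ^ (r+2)).trace =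
      ∑ x, ∑ y, ((T.adjMatrix ℝ) ^ (r+1)) x y * T.adjMatrix ℝ y x := by
    rw [pow_succ, Matrix.trace]; simp only [Matrix.diag, Matrix.mul_apply]
  rw [ht, ← hp]
  refine Finset.sum_congr rfl fun f _ => ?_
  simp only [adjMatrix_apply, Finset.prod_ite_zero, Finset.prod_const_one, Finset.mem_univ, true_implies]
  split_ifs <;> simp_all

theorem mem_dom (l p : ℕ) (hl : 1 ≤ l) (hp : 1 ≤ p) :
    (2*((l:ℝ)+p)*(2*p+1)-1) / (2*(l:ℝ)*(2*p+1)-1) ∈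
      domSet (cycleGraph (2*(l+p)+1)) (cycleGraph (2*l+1)) := by
  classical
  have hl' : (1:ℝ) ≤ l := by exact_mod_cast hl
  have hp' : (1:ℝ) ≤ p := by exact_mod_cast hp
  have hY : 0 < 2*(l:ℝ)*(2*p+1)-1 := by nlinarith
  have hX : 0 < 2*((l:ℝ)+p)*(2*p+1)-1 := by nlinarith
  refine ⟨(div_pos hX hY).le, fun n hn T => ?_⟩
  have hn' : (0:ℝ) < n := by exact_mod_cast hn
  obtain ⟨M, rfl⟩ : ∃ M, l = M + 1 := ⟨l-1, by omega⟩
  have c1 : (Nat.card (cycleGraph (2*(M+1)+1) →g T) : ℝ) =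
      ((T.adjMatrix ℝ) ^ (2*(M+1)+1)).trace := hom_cycle T (2*M+1)
  have c2 : (Nat.card (cycleGraph (2*(M+1+p)+1) →g T) : ℝ) =
      ((T.adjMatrix ℝ) ^ (2*(M+1)+1+2*p)).trace := by
    have e : 2*(M+1)+1+2*p = 2*M+2*p+1+2 := by ring
    have e' : 2*(M+1+p)+1 = 2*M+2*p+1+2 := by ring
    rw [e, e']; exact hom_cycle T _
  unfold homDensity
  rw [c1, c2]
  simp only [Fintype.card_fin]
  set A := T.adjMatrix ℝ with hA
  have h01 : ∀ x y, A x y = 0 ∨ A x y = 1 := by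
    intro x y; rw [hA, adjMatrix_apply]; split_ifs <;> simp
  have hs : ∀ x y, A x y = A y x := by
    intro x y; simp only [hA, adjMatrix_apply, T.adj_comm]
  have h0 : ∀ x y, 0 ≤ A x y := fun x y => by rcases h01 x y with h | h <;> simp [h]
  have hnn := pow_nonneg_entry A h0
  have htr : ∀ r, 0 ≤ (A ^ r).trace := fun r => Finset.sum_nonneg fun x _ => hnn r x x
  rcases (htr (2*(M+1)+1)).eq_or_lt with hz | hN
  · rw [← hz, zero_div, Real.zero_rpow (div_pos hX hY).ne']
    exact div_nonneg (htr _) (by positivity)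
  · have hN' : 0 < (A ^ (2*(M+1)+1+2*p)).trace := by
      obtain ⟨x, -, hx⟩ := Finset.exists_ne_zero_of_sum_ne_zero hN.ne'
      have := pow_back' A h0 hs (2*(M+1)) p x x (lt_of_le_of_ne (hnn _ _ _) (Ne.symm hx))
      exact lt_of_lt_of_le this (Finset.single_le_sum
        (f := fun x => (A ^ (2*(M+1)+1+2*p)) x x) (fun i _ => hnn _ _ _) (Finset.mem_univ x))
    have key := combined A h01 hs (M+1) p hl hN
    rw [Fintype.card_fin] at key
    set N := (A ^ (2*(M+1)+1)).trace
    set N' := (A ^ (2*(M+1)+1+2*p)).trace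
    rw [Real.rpow_def_of_pos (by positivity), ← Real.le_log_iff_exp_le (by positivity),
      ← mul_div_assoc, div_le_iff₀ hY, Real.log_div hN.ne' (by positivity),
      Real.log_div hN'.ne' (by positivity), Real.log_pow, Real.log_pow]
    push_cast at *
    linarith

theorem stmt_11 (k l : ℕ) (hl : 1 ≤ l) (hlk : l < k) :
    (k ≤ 2*l - 1 →
      domExp (cycleGraph (2*k+1)) (cycleGraph (2*l+1)) ≤
        (2*((k:ℝ)+1)) / (2*(l:ℝ)+1)) ∧
    (2*l ≤ k →
      domExp (cycleGraph (2*k+1)) (cycleGraph (2*l+1)) ≤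
        (2*(k:ℝ)*(2*(k:ℝ)-2*(l:ℝ)+1) - 1) / (2*(l:ℝ)*(2*(k:ℝ)-2*(l:ℝ)+1) - 1)) := by
  obtain ⟨p, rfl⟩ : ∃ p, k = l + p := ⟨k - l, by omega⟩
  have hl' : (1:ℝ) ≤ l := by exact_mod_cast hl
  have hp' : (1:ℝ) ≤ p := by exact_mod_cast (show 1 ≤ p by omega)
  have hY : 0 < 2*(l:ℝ)*(2*p+1)-1 := by nlinarith
  have main : domExp (cycleGraph (2*(l+p)+1)) (cycleGraph (2*l+1)) ≤
      (2*((l:ℝ)+p)*(2*p+1)-1) / (2*(l:ℝ)*(2*p+1)-1) :=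
    csInf_le ⟨0, fun c hc => hc.1⟩ (mem_dom l p hl (by omega))
  constructor
  · intro h
    refine main.trans ?_
    have h' : (p:ℝ) + 1 ≤ l := by exact_mod_cast (show p + 1 ≤ l by omega)
    rw [div_le_div_iff₀ hY (by positivity)]
    push_cast
    nlinarith
  · intro _
    refine main.trans (le_of_eq ?_)
    push_cast
    rw [show 2*((l:ℝ)+p) - 2*l + 1 = 2*p+1 by ring]
end

section
/- It holds that 15/7 ≤ C(C_5, C_3) ≤ 11/5. Moreover, C(C_5^+, C_3) = 11/5, where C_5^+ is the graph obtained from the 5-cycle C_5 by adding one diagonal edge (a chord joining two vertices at distance two on the cycle). -/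
open SimpleGraph

/-- `C_5^+`: the 5-cycle `0-1-2-3-4-0` together with the chord `{0,2}`. -/
def C5plus : SimpleGraph (Fin 5) :=
  SimpleGraph.fromRel (fun x y => (x.val + 1) % 5 = y.val ∨ (x = 0 ∧ y = 2))

/-- log-sum inequality -/
lemma logsum_s13 {ι : Type*} [Fintype ι] (r k : ι → ℝ) (hr : ∀ i, 0 ≤ r i) (hk : ∀ i, 0 ≤ k i)
    (h : ∀ i, 0 < r i → 0 < k i) :
    ∑ i, r i * (Real.log (∑ j, r j) + Real.log (k i) - Real.log (r i)) ≤
      (∑ i, r i) * Real.log (∑ i, k i) := by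
  set Rs := ∑ j, r j with hRs
  set K := ∑ j, k j with hK
  have hR0 : 0 ≤ Rs := Finset.sum_nonneg fun i _ => hr i
  rcases hR0.eq_or_lt with h0 | hpos
  · have : ∀ i, r i = 0 := by
      intro i
      have := (Finset.sum_eq_zero_iff_of_nonneg (fun i _ => hr i)).1 h0.symm
      exact this i (Finset.mem_univ i)
    simp [this, ← h0]
  have hKpos : 0 < K := by
    obtain ⟨i, -, hi⟩ := Finset.exists_lt_of_sum_lt (s := Finset.univ) (f := fun _ : ι => (0:ℝ)) (g := r)
      (by simpa using hpos)
    exact Finset.sum_pos' (fun i _ => hk i) ⟨i, Finset.mem_univ i, h i hi⟩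
  have key : ∀ i, r i * (Real.log Rs + Real.log (k i) - Real.log (r i)) ≤
      r i * Real.log K + (Rs * k i / K - r i) := by
    intro i
    rcases (hr i).eq_or_lt with h0 | hp
    · rw [← h0]; simp; exact div_nonneg (mul_nonneg hR0 (hk i)) hKpos.le
    · have hki := h i hp
      have := Real.log_le_sub_one_of_pos (x := Rs * k i / (K * r i)) (by positivity)
      rw [Real.log_div (by positivity) (by positivity), Real.log_mul (by positivity) (by positivity),
        Real.log_mul (by positivity) (by positivity)] at this
      have h2 := mul_le_mul_of_nonneg_left this hp.le
      have h3 : r i * (Rs * k i / (K * r i) - 1) = Rs * k i / K - r i := by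
        field_simp
      rw [h3] at h2
      linarith
  calc _ ≤ ∑ i, (r i * Real.log K + (Rs * k i / K - r i)) := Finset.sum_le_sum fun i _ => key i
    _ = _ := by
      rw [Finset.sum_add_distrib, Finset.sum_sub_distrib, ← Finset.sum_mul, ← Finset.sum_div,
        ← Finset.mul_sum, ← hK, ← hRs]
      field_simp
      ring

section core
variable {V : Type*} [Fintype V]

/-- triangles on a pair -/
noncomputable def wt (A : V → V → ℝ) (x y : V) : ℝ := ∑ z, A x y * A y z * A z x
noncomputable def cdg (A : V → V → ℝ) (x y : V) : ℝ := ∑ a, A x a * A a y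
noncomputable def pth (A : V → V → ℝ) (x y : V) : ℝ := ∑ b, cdg A x b * A b y
noncomputable def Wt (A : V → V → ℝ) (x : V) : ℝ := ∑ y, wt A x y
noncomputable def Nt (A : V → V → ℝ) : ℝ := ∑ x, Wt A x
noncomputable def St (A : V → V → ℝ) : ℝ := ∑ x, ∑ y, wt A x y * pth A x y
noncomputable def Lt (A : V → V → ℝ) : ℝ := ∑ x, ∑ y, wt A x y * Real.log (wt A x y)
noncomputable def Rt (A : V → V → ℝ) (x b : V) : ℝ := ∑ a, wt A x a * wt A a b / Wt A a

variable (A : V → V → ℝ) (hs : ∀ x y, A x y = A y x) (h01 : ∀ x y, A x y = 0 ∨ A x y = 1)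
include hs h01

omit hs in
lemma A_nn (x y : V) : 0 ≤ A x y := by rcases h01 x y with h | h <;> rw [h] <;> norm_num

omit hs in
lemma wt_nn (x y : V) : 0 ≤ wt A x y :=
  Finset.sum_nonneg fun z _ => mul_nonneg (mul_nonneg (A_nn A h01 _ _) (A_nn A h01 _ _)) (A_nn A h01 _ _)

omit h01 in
lemma wt_symm (x y : V) : wt A x y = wt A y x := by
  unfold wt
  refine Finset.sum_congr rfl fun z _ => ?_
  rw [hs x y, hs y z, hs z x]; ring

omit hs in
lemma A_of_wt {x y : V} (h : 0 < wt A x y) : A x y = 1 := by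
  rcases h01 x y with h' | h'
  · simp [wt, h'] at h
  · exact h'

omit hs in
lemma Wt_nn (x : V) : 0 ≤ Wt A x := Finset.sum_nonneg fun y _ => wt_nn A h01 x y

omit hs in
lemma Wt_pos {x y : V} (h : 0 < wt A x y) : 0 < Wt A x :=
  Finset.sum_pos' (fun y _ => wt_nn A h01 x y) ⟨y, Finset.mem_univ y, h⟩

omit hs in
lemma cdg_nn (x y : V) : 0 ≤ cdg A x y :=
  Finset.sum_nonneg fun z _ => mul_nonneg (A_nn A h01 _ _) (A_nn A h01 _ _)

omit hs in
lemma pth_nn (x y : V) : 0 ≤ pth A x y :=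
  Finset.sum_nonneg fun z _ => mul_nonneg (cdg_nn A h01 _ _) (A_nn A h01 _ _)

lemma pth_pos {x y : V} (h : 0 < wt A x y) : 0 < pth A x y := by
  have hA := A_of_wt A h01 h
  have hc : 0 < cdg A x x := Finset.sum_pos' (fun z _ => mul_nonneg (A_nn A h01 _ _) (A_nn A h01 _ _))
    ⟨y, Finset.mem_univ y, by rw [hs y x, hA]; norm_num⟩
  exact Finset.sum_pos' (fun z _ => mul_nonneg (cdg_nn A h01 _ _) (A_nn A h01 _ _))
    ⟨x, Finset.mem_univ x, by rw [hA]; simpa using hc⟩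

/-- sum of a function of the middle -/
noncomputable def El (A : V → V → ℝ) : ℝ := ∑ x, ∑ y, wt A x y * Real.log (pth A x y)

/-- step 0 -/
lemma step0 : Nt A * Real.log (Nt A) + El A ≤ Nt A * Real.log (St A) := by
  have := logsum_s13 (ι := V × V) (fun e => wt A e.1 e.2) (fun e => wt A e.1 e.2 * pth A e.1 e.2)
    (fun e => wt_nn A h01 _ _) (fun e => mul_nonneg (wt_nn A h01 _ _) (pth_nn A h01 _ _))
    (fun e he => mul_pos he (pth_pos A hs h01 he))
  simp only [Fintype.sum_prod_type] at this
  change _ ≤ Nt A * Real.log (St A) at this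
  refine le_trans (le_of_eq ?_) this
  change _ = ∑ x, ∑ y, wt A x y * (Real.log (Nt A) + Real.log (wt A x y * pth A x y) - Real.log (wt A x y))
  have : ∀ x y, wt A x y * (Real.log (Nt A) + Real.log (wt A x y * pth A x y) - Real.log (wt A x y))
      = wt A x y * Real.log (Nt A) + wt A x y * Real.log (pth A x y) := by
    intro x y
    rcases (wt_nn A h01 x y).eq_or_lt with h | h
    · rw [← h]; simp
    · rw [Real.log_mul h.ne' (pth_pos A hs h01 h).ne']; ring
  simp only [this, Finset.sum_add_distrib, ← Finset.sum_mul]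
  rfl

/-- inequality A -/
lemma stepA : 2 * Lt A ≤ El A := by
  -- for an edge
  have key : ∀ x y, wt A x y * Real.log (wt A x y) + ∑ z, A x y * A y z * A z x * Real.log (wt A x z)
      ≤ wt A x y * Real.log (pth A x y) := by
    intro x y
    have h := logsum_s13 (fun z => A x y * A y z * A z x) (fun z => A x y * A y z * A z x * wt A x z)
      (fun z => mul_nonneg (mul_nonneg (A_nn A h01 _ _) (A_nn A h01 _ _)) (A_nn A h01 _ _))
      (fun z => mul_nonneg (mul_nonneg (mul_nonneg (A_nn A h01 _ _) (A_nn A h01 _ _)) (A_nn A h01 _ _)) (wt_nn A h01 _ _))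
      (by
        intro z hz
        refine mul_pos hz ?_
        refine Finset.sum_pos' (fun z _ => mul_nonneg (mul_nonneg (A_nn A h01 _ _) (A_nn A h01 _ _)) (A_nn A h01 _ _)) ⟨y, Finset.mem_univ y, ?_⟩
        rw [hs x z, hs z y, hs y x]; linarith)
    change _ ≤ wt A x y * _ at h
    change ∑ z, A x y * A y z * A z x * (Real.log (wt A x y) + _ - _) ≤ _ at h
    have e1 : ∀ z, A x y * A y z * A z x * (Real.log (wt A x y) + Real.log (A x y * A y z * A z x * wt A x z)
        - Real.log (A x y * A y z * A z x)) = A x y * A y z * A z x * Real.log (wt A x y) +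
          A x y * A y z * A z x * Real.log (wt A x z) := by
      intro z
      rcases h01 x y with h1 | h1 <;> rcases h01 y z with h2 | h2 <;> rcases h01 z x with h3 | h3 <;>
        simp [h1, h2, h3]
    simp only [e1, Finset.sum_add_distrib, ← Finset.sum_mul] at h
    change wt A x y * _ + _ ≤ _ at h
    refine h.trans ?_
    rcases (wt_nn A h01 x y).eq_or_lt with h0 | h0
    · rw [← h0]; simp
    refine mul_le_mul_of_nonneg_left ?_ h0.le
    refine Real.log_le_log ?_ ?_
    · obtain ⟨z, -, hz⟩ := Finset.exists_lt_of_sum_lt (s := Finset.univ) (f := fun _ : V => (0:ℝ))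
        (g := fun z => A x y * A y z * A z x) (by rw [Finset.sum_const_zero]; exact h0)
      refine Finset.sum_pos' (fun z _ => mul_nonneg (mul_nonneg (mul_nonneg (A_nn A h01 _ _) (A_nn A h01 _ _)) (A_nn A h01 _ _)) (wt_nn A h01 _ _)) ⟨z, Finset.mem_univ z, mul_pos hz ?_⟩
      refine Finset.sum_pos' (fun z _ => mul_nonneg (mul_nonneg (A_nn A h01 _ _) (A_nn A h01 _ _)) (A_nn A h01 _ _)) ⟨y, Finset.mem_univ y, ?_⟩
      rw [hs x z, hs z y, hs y x]; linarith
    · refine Finset.sum_le_sum fun z _ => ?_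
      have hw : wt A x z ≤ cdg A x z := by
        refine Finset.sum_le_sum fun a _ => ?_
        rw [hs a x, hs z a]
        rcases h01 x z with h1 | h1 <;> rcases h01 a z with h2 | h2 <;> rcases h01 x a with h3 | h3 <;>
        simp [h1, h2, h3]
      rw [hs y z]
      have := wt_nn A h01 x z
      have := cdg_nn A h01 x z
      rcases h01 x y with h1 | h1 <;> rcases h01 z y with h2 | h2 <;> rcases h01 z x with h3 | h3 <;>
        simp [h1, h2, h3] <;> linarith
  have h2 : ∑ x, ∑ y, (wt A x y * Real.log (wt A x y) + ∑ z, A x y * A y z * A z x * Real.log (wt A x z)) ≤ El A :=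
    Finset.sum_le_sum fun x _ => Finset.sum_le_sum fun y _ => key x y
  refine le_trans (le_of_eq ?_) h2
  simp only [Finset.sum_add_distrib]
  rw [two_mul]
  congr 1
  refine Finset.sum_congr rfl fun x _ => ?_
  rw [Finset.sum_comm]
  refine Finset.sum_congr rfl fun z _ => ?_
  rw [← Finset.sum_mul]
  congr 1
  refine Finset.sum_congr rfl fun y _ => ?_
  rw [hs x z, hs z y, hs y x]; ring

/-- Jensen for Wt -/
lemma stepW : Nt A * Real.log (Nt A) - Nt A * Real.log (Fintype.card V) ≤ ∑ x, Wt A x * Real.log (Wt A x) := by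
  have h := logsum_s13 (Wt A) (fun _ => 1) (Wt_nn A h01) (fun _ => zero_le_one) (fun _ _ => zero_lt_one)
  change _ ≤ Nt A * _ at h
  change ∑ x, Wt A x * (Real.log (Nt A) + _ - _) ≤ _ at h
  simp only [Real.log_one, add_zero, mul_sub, Finset.sum_sub_distrib, ← Finset.sum_mul] at h
  change Nt A * _ - _ ≤ _ at h
  simp at h
  linarith

omit hs in
lemma Rt_nn (x y : V) : 0 ≤ Rt A x y :=
  Finset.sum_nonneg fun z _ => div_nonneg (mul_nonneg (wt_nn A h01 _ _) (wt_nn A h01 _ _)) (Wt_nn A h01 _)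

omit hs in
lemma wt_W (x y : V) : wt A x y * Wt A x / Wt A x = wt A x y := by
  rcases (wt_nn A h01 x y).eq_or_lt with h | h
  · rw [← h]; simp
  · have := Wt_pos A h01 h
    field_simp

lemma sum_q (x a : V) : ∑ b, wt A x a * wt A a b / Wt A a = wt A x a := by
  rw [← Finset.sum_div, ← Finset.mul_sum]
  change _ * Wt A a / _ = _
  rw [wt_symm A hs x a]
  exact wt_W A h01 a x

lemma sum_q' (a b : V) : ∑ x, wt A x a * wt A a b / Wt A a = wt A a b := by
  rw [← Finset.sum_div, ← Finset.sum_mul]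
  have : ∑ x, wt A x a = Wt A a := Finset.sum_congr rfl fun x _ => wt_symm A hs x a
  rw [this, mul_comm]
  exact wt_W A h01 a b

lemma sum_R : ∑ x, ∑ b, Rt A x b = Nt A := by
  unfold Rt Nt Wt
  refine Finset.sum_congr rfl fun x _ => ?_
  rw [Finset.sum_comm]
  exact Finset.sum_congr rfl fun a _ => sum_q A hs h01 x a

lemma stepR : Nt A * Real.log (Nt A) - 2 * (Nt A * Real.log (Fintype.card V))
    ≤ ∑ x, ∑ b, Rt A x b * Real.log (Rt A x b) := by
  have h := logsum_s13 (ι := V × V) (fun e => Rt A e.1 e.2) (fun _ => 1) (fun e => Rt_nn A h01 _ _)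
    (fun _ => zero_le_one) (fun _ _ => zero_lt_one)
  simp only [Real.log_one, add_zero, mul_sub, Finset.sum_sub_distrib, ← Finset.sum_mul] at h
  simp only [Fintype.sum_prod_type] at h
  rw [sum_R A hs h01] at h
  simp at h
  rcases eq_or_ne (Fintype.card V : ℝ) 0 with h0 | h0
  · rw [h0] at h ⊢; simp at h ⊢; linarith
  rw [Real.log_mul h0 h0] at h
  linarith

/-- inequality B -/
lemma stepB : 3 * (Nt A * Real.log (Nt A)) - 3 * Lt A - 4 * (Nt A * Real.log (Fintype.card V)) ≤ El A := by
  -- first stage: b given y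
  have posq : ∀ x a b, 0 < wt A x a * wt A a b / Wt A a → 0 < wt A x a ∧ 0 < wt A a b ∧ 0 < Wt A a := by
    intro x a b h
    have h1 : 0 < wt A x a := by
      rcases (wt_nn A h01 x a).eq_or_lt with h' | h'
      · rw [← h'] at h; simp at h
      · exact h'
    have h2 : 0 < wt A a b := by
      rcases (wt_nn A h01 a b).eq_or_lt with h' | h'
      · rw [← h'] at h; simp at h
      · exact h'
    exact ⟨h1, h2, Wt_pos A h01 h2⟩
  have cpos : ∀ x a b, 0 < wt A x a → 0 < wt A a b → 0 < cdg A x b := by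
    intro x a b h1 h2
    refine Finset.sum_pos' (fun z _ => mul_nonneg (A_nn A h01 _ _) (A_nn A h01 _ _)) ⟨a, Finset.mem_univ a, ?_⟩
    rw [A_of_wt A h01 h1, A_of_wt A h01 h2]; norm_num
  have k1 : ∀ x y, ∑ b, wt A x y * wt A y b / Wt A y *
      (Real.log (cdg A x b) + Real.log (Wt A y) - Real.log (wt A y b)) ≤ wt A x y * Real.log (pth A x y) := by
    intro x y
    have h := logsum_s13 (fun b => wt A x y * wt A y b / Wt A y) (fun b => cdg A x b * A b y)
      (fun b => div_nonneg (mul_nonneg (wt_nn A h01 _ _) (wt_nn A h01 _ _)) (Wt_nn A h01 _))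
      (fun b => mul_nonneg (cdg_nn A h01 _ _) (A_nn A h01 _ _))
      (by
        intro b hb
        obtain ⟨h1, h2, h3⟩ := posq _ _ _ hb
        rw [hs b y, A_of_wt A h01 h2, mul_one]
        exact cpos _ _ _ h1 h2)
    rw [sum_q A hs h01] at h
    refine le_trans (le_of_eq (Finset.sum_congr rfl fun b _ => ?_)) h
    rcases (div_nonneg (mul_nonneg (wt_nn A h01 x y) (wt_nn A h01 y b)) (Wt_nn A h01 y)).eq_or_lt with h' | h'
    · rw [← h']; simp
    · obtain ⟨h1, h2, h3⟩ := posq _ _ _ h'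
      congr 1
      rw [hs b y, A_of_wt A h01 h2, mul_one, Real.log_div (by positivity) (by positivity),
        Real.log_mul (by positivity) (by positivity)]
      ring
  have k2 : ∀ x b, ∑ a, wt A x a * wt A a b / Wt A a *
      (Real.log (Rt A x b) + Real.log (Wt A a) - Real.log (wt A x a) - Real.log (wt A a b))
        ≤ Rt A x b * Real.log (cdg A x b) := by
    intro x b
    have h := logsum_s13 (fun a => wt A x a * wt A a b / Wt A a) (fun a => A x a * A a b)
      (fun a => div_nonneg (mul_nonneg (wt_nn A h01 _ _) (wt_nn A h01 _ _)) (Wt_nn A h01 _))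
      (fun a => mul_nonneg (A_nn A h01 _ _) (A_nn A h01 _ _))
      (by
        intro a ha
        obtain ⟨h1, h2, h3⟩ := posq _ _ _ ha
        rw [A_of_wt A h01 h1, A_of_wt A h01 h2]; norm_num)
    refine le_trans (le_of_eq (Finset.sum_congr rfl fun a _ => ?_)) h
    change _ = _ * (Real.log (Rt A x b) + _ - _)
    rcases (div_nonneg (mul_nonneg (wt_nn A h01 x a) (wt_nn A h01 a b)) (Wt_nn A h01 a)).eq_or_lt with h' | h'
    · rw [← h']; simp
    · obtain ⟨h1, h2, h3⟩ := posq _ _ _ h'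
      congr 1
      rw [A_of_wt A h01 h1, A_of_wt A h01 h2, mul_one, Real.log_div (by positivity) (by positivity),
        Real.log_mul (by positivity) (by positivity), Real.log_one]
      ring
  -- marginals
  have mW : ∀ g : V → ℝ, ∑ x, ∑ a, ∑ b, wt A x a * wt A a b / Wt A a * g a = ∑ a, Wt A a * g a := by
    intro g
    rw [Finset.sum_comm]
    refine Finset.sum_congr rfl fun a _ => ?_
    simp only [← Finset.sum_mul, sum_q A hs h01]
    congr 1
    exact Finset.sum_congr rfl fun x _ => wt_symm A hs x a
  have m1 : ∀ g : V → V → ℝ, ∑ x, ∑ a, ∑ b, wt A x a * wt A a b / Wt A a * g x a = ∑ x, ∑ a, wt A x a * g x a := by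
    intro g
    simp only [← Finset.sum_mul, sum_q A hs h01]
  have m2 : ∀ g : V → V → ℝ, ∑ x, ∑ a, ∑ b, wt A x a * wt A a b / Wt A a * g a b = ∑ a, ∑ b, wt A a b * g a b := by
    intro g
    rw [Finset.sum_comm]
    refine Finset.sum_congr rfl fun a _ => ?_
    rw [Finset.sum_comm]
    simp only [← Finset.sum_mul, sum_q' A hs h01]
  have m3 : ∀ g : V → V → ℝ, ∑ x, ∑ a, ∑ b, wt A x a * wt A a b / Wt A a * g x b = ∑ x, ∑ b, Rt A x b * g x b := by
    intro g
    refine Finset.sum_congr rfl fun x _ => ?_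
    rw [Finset.sum_comm]
    simp only [← Finset.sum_mul]
    rfl
  have s1 : ∑ x, ∑ y, ∑ b, wt A x y * wt A y b / Wt A y *
      (Real.log (cdg A x b) + Real.log (Wt A y) - Real.log (wt A y b)) ≤ El A :=
    Finset.sum_le_sum fun x _ => Finset.sum_le_sum fun y _ => k1 x y
  have s2 : ∑ x, ∑ b, ∑ a, wt A x a * wt A a b / Wt A a *
      (Real.log (Rt A x b) + Real.log (Wt A a) - Real.log (wt A x a) - Real.log (wt A a b))
      ≤ ∑ x, ∑ b, Rt A x b * Real.log (cdg A x b) :=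
    Finset.sum_le_sum fun x _ => Finset.sum_le_sum fun y _ => k2 x y
  have s2' : ∑ x, ∑ a, ∑ b, wt A x a * wt A a b / Wt A a *
      (Real.log (Rt A x b) + Real.log (Wt A a) - Real.log (wt A x a) - Real.log (wt A a b))
      ≤ ∑ x, ∑ b, Rt A x b * Real.log (cdg A x b) := by
    refine le_trans (le_of_eq (Finset.sum_congr rfl fun x _ => Finset.sum_comm)) s2
  simp only [mul_sub, mul_add, Finset.sum_sub_distrib, Finset.sum_add_distrib] at s1 s2'
  rw [m3 (fun x b => Real.log (cdg A x b)), mW (fun a => Real.log (Wt A a)), m2 (fun a b => Real.log (wt A a b))] at s1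
  rw [m3 (fun x b => Real.log (Rt A x b)), mW (fun a => Real.log (Wt A a)), m2 (fun a b => Real.log (wt A a b)),
    m1 (fun a b => Real.log (wt A a b))] at s2'
  have hW := stepW A hs h01
  have hR := stepR A hs h01
  change _ + _ - Lt A ≤ _ at s1
  change _ + _ - Lt A - Lt A ≤ _ at s2'
  linarith

lemma core_ineq : (Nt A / (Fintype.card V : ℝ) ^ 3) ^ (11/5 : ℝ) ≤ St A / (Fintype.card V : ℝ) ^ 5 := by
  have hN : 0 ≤ Nt A := Finset.sum_nonneg fun x _ => Wt_nn A h01 x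
  have hS : 0 ≤ St A := Finset.sum_nonneg fun x _ => Finset.sum_nonneg fun y _ =>
    mul_nonneg (wt_nn A h01 x y) (pth_nn A h01 x y)
  rcases hN.eq_or_lt with h0 | hN
  · rw [← h0, zero_div, Real.zero_rpow (by norm_num)]; positivity
  have hn : 0 < (Fintype.card V : ℝ) := by
    rcases Nat.eq_zero_or_pos (Fintype.card V) with h | h
    · exfalso
      have := Fintype.card_eq_zero_iff.1 h
      simp [Nt] at hN
    · exact_mod_cast h
  have hSp : 0 < St A := by
    refine hS.lt_of_ne' ?_
    intro hS0
    obtain ⟨x, -, hx⟩ := Finset.exists_lt_of_sum_lt (s := Finset.univ) (f := fun _ : V => (0:ℝ))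
        (g := Wt A) (by rw [Finset.sum_const_zero]; exact hN)
    obtain ⟨y, -, hy⟩ := Finset.exists_lt_of_sum_lt (s := Finset.univ) (f := fun _ : V => (0:ℝ))
        (g := wt A x) (by rw [Finset.sum_const_zero]; exact hx)
    have : 0 < St A := by
      refine Finset.sum_pos' (fun x _ => Finset.sum_nonneg fun y _ =>
        mul_nonneg (wt_nn A h01 x y) (pth_nn A h01 x y)) ⟨x, Finset.mem_univ x, ?_⟩
      exact Finset.sum_pos' (fun y _ =>
        mul_nonneg (wt_nn A h01 x y) (pth_nn A h01 x y)) ⟨y, Finset.mem_univ y, mul_pos hy (pth_pos A hs h01 hy)⟩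
    linarith
  have e0 := step0 A hs h01
  have eA := stepA A hs h01
  have eB := stepB A hs h01
  have key : Nt A * (11/5 * Real.log (Nt A) - 8/5 * Real.log (Fintype.card V)) ≤ Nt A * Real.log (St A) := by
    linarith
  have key := le_of_mul_le_mul_left key hN
  rw [← Real.log_le_log_iff (by positivity) (by positivity), Real.log_rpow (by positivity),
    Real.log_div (by positivity) (by positivity), Real.log_div (by positivity) (by positivity), Real.log_pow, Real.log_pow]
  push_cast
  linarith
end core
lemma homDensity_iso {α β γ : Type*} [Fintype α] [Fintype β] [Fintype γ]
    (G : SimpleGraph α) (T : SimpleGraph β) (T' : SimpleGraph γ) (e : T ≃g T') :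
    homDensity G T = homDensity G T' := by
  unfold homDensity
  rw [Fintype.card_congr e.toEquiv]
  congr 2
  refine Nat.card_congr ⟨fun f => e.toHom.comp f, fun f => e.symm.toHom.comp f, ?_, ?_⟩
  · intro f; ext x; simp
  · intro f; ext x; simp

lemma domSet_apply {α β γ : Type*} [Fintype α] [Fintype β] [Fintype γ] [Nonempty γ]
    (G : SimpleGraph α) (H : SimpleGraph β) (T : SimpleGraph γ) {c : ℝ} (hc : c ∈ domSet G H) :
    homDensity H T ^ c ≤ homDensity G T := by
  classical
  have := hc.2 (Fintype.card γ) Fintype.card_pos (T.overFin rfl)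
  rwa [← homDensity_iso H T _ (T.overFinIso rfl), ← homDensity_iso G T _ (T.overFinIso rfl)] at this

lemma card_sub {α : Type*} [Fintype α] (P : α → Prop) [DecidablePred P] :
    (Nat.card {p : α // P p} : ℝ) = ∑ p, if P p then (1:ℝ) else 0 := by
  rw [Nat.card_eq_fintype_card, Fintype.card_subtype, Finset.sum_boole]

lemma C5_le : cycleGraph 5 ≤ C5plus := by
  intro a b h
  revert a b
  simp only [C5plus, SimpleGraph.fromRel_adj, cycleGraph_adj]
  decide

def homC3 {V : Type*} (T : SimpleGraph V) : (cycleGraph 3 →g T) ≃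
    {p : V × V × V // T.Adj p.1 p.2.1 ∧ T.Adj p.2.1 p.2.2 ∧ T.Adj p.2.2 p.1} where
  toFun f := ⟨(f 0, f 1, f 2), f.map_rel (by simp [cycleGraph_adj]), f.map_rel (by simp [cycleGraph_adj]),
    f.map_rel (by simp only [cycleGraph_adj]; decide)⟩
  invFun p := ⟨![p.1.1, p.1.2.1, p.1.2.2], by
    obtain ⟨⟨x, y, z⟩, h1, h2, h3⟩ := p
    intro a b _
    have h1' := h1.symm
    have h2' := h2.symm
    have h3' := h3.symm
    fin_cases a <;> fin_cases b <;> simp_all⟩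
  left_inv f := by
    ext i; fin_cases i <;> rfl
  right_inv p := rfl

def homC5p {V : Type*} (T : SimpleGraph V) : (C5plus →g T) ≃
    {p : V × V × V × V × V // T.Adj p.1 p.2.1 ∧ T.Adj p.2.1 p.2.2.1 ∧ T.Adj p.2.2.1 p.1 ∧
      T.Adj p.1 p.2.2.2.2 ∧ T.Adj p.2.2.2.2 p.2.2.2.1 ∧ T.Adj p.2.2.2.1 p.2.1} where
  toFun f := ⟨(f 0, f 2, f 1, f 3, f 4), f.map_rel (by simp [C5plus]),
    f.map_rel (by simp [C5plus]), f.map_rel (by simp [C5plus]), f.map_rel (by simp [C5plus]),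
    f.map_rel (by simp [C5plus]), f.map_rel (by simp [C5plus])⟩
  invFun p := ⟨![p.1.1, p.1.2.2.1, p.1.2.1, p.1.2.2.2.1, p.1.2.2.2.2], by
    obtain ⟨⟨x, y, z, b, a⟩, h1, h2, h3, h4, h5, h6⟩ := p
    intro i j hij
    simp only [C5plus, SimpleGraph.fromRel_adj] at hij
    have h1' := h1.symm
    have h2' := h2.symm
    have h3' := h3.symm
    have h4' := h4.symm
    have h5' := h5.symm
    have h6' := h6.symm
    fin_cases i <;> fin_cases j <;> simp_all⟩
  left_inv f := by
    ext i; fin_cases i <;> rfl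
  right_inv p := rfl


section constr
variable {p : ℕ} [Fact p.Prime] {m : ℕ}

/-- moment curve -/
def mom (p m : ℕ) (t : ZMod p) : Fin m → ZMod p := fun i => t ^ (i : ℕ)

lemma class_sum {k : ℕ} (hk : k ≤ m) (s t : Fin k → ZMod p) (h : ∑ i, s i • mom p m (t i) = 0)
    (c : ZMod p) : ∑ i with t i = c, s i = 0 := by
  classical
  by_cases hc : ∃ i, t i = c
  swap
  · push Not at hc
    apply Finset.sum_eq_zero
    intro i hi
    exact absurd (Finset.mem_filter.1 hi).2 (hc i)
  set D := (Finset.univ.image t).erase c with hD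
  let P : Polynomial (ZMod p) := ∏ d ∈ D, (Polynomial.X - Polynomial.C d)
  have hdeg : P.natDegree < m := by
    have h1 : P.natDegree = D.card := by
      simp [P]
    have h2 : D.card < k := by
      have h3 : D.card < (Finset.univ.image t).card := Finset.card_erase_lt_of_mem (by
        obtain ⟨i, hi⟩ := hc
        exact Finset.mem_image.2 ⟨i, Finset.mem_univ i, hi⟩)
      have h4 : (Finset.univ.image t).card ≤ k := by
        simpa using Finset.card_image_le (s := (Finset.univ : Finset (Fin k))) (f := t)
      omega
    omega
  have hz : ∑ i, s i * P.eval (t i) = 0 := by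
    simp only [Polynomial.eval_eq_sum_range' hdeg, Finset.mul_sum]
    rw [Finset.sum_comm]
    apply Finset.sum_eq_zero
    intro j hj
    have hj' := Finset.mem_range.1 hj
    have := congrFun h ⟨j, hj'⟩
    simp [mom, Finset.sum_apply] at this
    calc _ = P.coeff j * ∑ i, s i * t i ^ j := by
          rw [Finset.mul_sum]; exact Finset.sum_congr rfl fun i _ => by ring
      _ = 0 := by rw [this, mul_zero]
  have hP : ∀ i, s i * P.eval (t i) = if t i = c then s i * P.eval c else 0 := by
    intro i
    split_ifs with hi
    · rw [hi]
    · have : P.eval (t i) = 0 := by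
        simp only [P, Polynomial.eval_prod]
        exact Finset.prod_eq_zero (i := t i) (by simp [hD, hi]) (by simp)
      rw [this, mul_zero]
  simp only [hP] at hz
  rw [← Finset.sum_filter, ← Finset.sum_mul] at hz
  rcases mul_eq_zero.1 hz with h1 | h1
  · exact h1
  · exfalso
    simp only [P, Polynomial.eval_prod] at h1
    obtain ⟨d, hd, h2⟩ := Finset.prod_eq_zero_iff.1 h1
    simp [sub_eq_zero] at h2
    simp [hD, h2] at hd

/-- zero sums -/
def Zs (p m k : ℕ) : Type := {st : Fin k → ZMod p × ZMod p // ∑ i, (st i).1 • mom p m (st i).2 = 0}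

instance (k : ℕ) : Finite (Zs p m k) := by unfold Zs; infer_instance

lemma card_Zs {k : ℕ} (hk : k + 1 ≤ m) : Nat.card (Zs p m (k+1)) ≤ (k+1)^(k+1) * p^(k+1) := by
  classical
  let rep : (Fin (k+1) → ZMod p) → Fin (k+1) → Fin (k+1) := fun t i => Function.invFun t (t i)
  have rep1 : ∀ (t : Fin (k+1) → ZMod p) i, t (rep t i) = t i := fun t i => Function.invFun_eq ⟨i, rfl⟩
  have rep2 : ∀ (t : Fin (k+1) → ZMod p) i j, t i = t j → rep t i = rep t j := fun t i j h => by simp only [rep, h]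
  let enc : Zs p m (k+1) → (Fin (k+1) → Fin (k+1)) × (Fin (k+1) → ZMod p) := fun z =>
    (rep (fun i => (z.1 i).2), fun i => if rep (fun i => (z.1 i).2) i = i then (z.1 i).2 else (z.1 i).1)
  have hinj : Function.Injective enc := by
    rintro ⟨f, hf⟩ ⟨g, hg⟩ h
    simp only [enc, Prod.mk.injEq] at h
    obtain ⟨h1, h2⟩ := h
    set t := fun i => (f i).2 with ht
    set t' := fun i => (g i).2 with ht'
    have htt : t = t' := by
      funext i
      have h3 := congrFun h2 (rep t i)
      have e1 : rep t (rep t i) = rep t i := rep2 t _ _ (rep1 t i)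
      rw [← h1] at h3
      simp only [e1, if_true] at h3
      change t (rep t i) = t' (rep t i) at h3
      rw [rep1 t, h1, rep1 t'] at h3
      exact h3
    have hs1 : ∀ i, rep t i ≠ i → (f i).1 = (g i).1 := by
      intro i hi
      have h3 := congrFun h2 i
      rw [← h1] at h3
      simpa only [hi, if_false] using h3
    have hs2 : ∀ i, (f i).1 = (g i).1 := by
      intro i
      by_cases hi : rep t i = i
      swap
      · exact hs1 i hi
      have c1 := class_sum hk (fun i => (f i).1) t hf (t i)
      have c2 := class_sum hk (fun i => (g i).1) t' hg (t i)
      rw [← htt] at c2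
      have hmem : i ∈ Finset.univ.filter (fun j => t j = t i) := by simp
      rw [← Finset.add_sum_erase _ _ hmem] at c1 c2
      have : ∑ x ∈ (Finset.univ.filter (fun j => t j = t i)).erase i, (f x).1 =
          ∑ x ∈ (Finset.univ.filter (fun j => t j = t i)).erase i, (g x).1 := by
        refine Finset.sum_congr rfl fun j hj => ?_
        simp at hj
        apply hs1
        rw [rep2 t j i hj.2, hi]
        exact fun h => hj.1 h.symm
      rw [this] at c1
      exact add_right_cancel (c1.trans c2.symm)
    apply Subtype.ext
    funext i
    exact Prod.ext (hs2 i) (congrFun htt i)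
  have := Nat.card_le_card_of_injective enc hinj
  simpa [Nat.card_prod, Nat.card_fun] using this

/-- Cayley graph -/
def Cay (p m : ℕ) : SimpleGraph (Fin m → ZMod p) where
  Adj x y := x ≠ y ∧ ∃ st : ZMod p × ZMod p, y - x = st.1 • mom p m st.2
  symm := ⟨by
    rintro x y ⟨h, ⟨s, t⟩, hst⟩
    refine ⟨h.symm, (-s, t), ?_⟩
    simp only [neg_smul] at hst ⊢
    rw [← hst]; simp⟩
  loopless := ⟨fun x h => h.1 rfl⟩

lemma tri_line (hm : 3 ≤ m) {x y z : Fin m → ZMod p} (hxy : (Cay p m).Adj x y) (hyz : (Cay p m).Adj y z)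
    (hxz : x ≠ z) (st : ZMod p × ZMod p) (h : z - x = st.1 • mom p m st.2) :
    ∃ s' : ZMod p, y - x = s' • mom p m st.2 := by
  classical
  obtain ⟨n1, ⟨a, u⟩, h1⟩ := hxy
  obtain ⟨n2, ⟨b, v⟩, h2⟩ := hyz
  obtain ⟨s, t⟩ := st
  simp only at h h1 h2 ⊢
  by_cases hut : u = t
  · exact ⟨a, by rw [h1, hut]⟩
  exfalso
  have hsum : ∑ i, (![a, b, -s] i) • mom p m (![u, v, t] i) = 0 := by
    simp only [Fin.sum_univ_three, Matrix.cons_val_zero, Matrix.cons_val_one, Matrix.cons_val, neg_smul]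
    rw [← h, ← h1, ← h2]; abel
  have cs := class_sum hm ![a, b, -s] ![u, v, t] hsum
  have ha : a ≠ 0 := by rintro rfl; apply n1; rw [zero_smul, sub_eq_zero] at h1; exact h1.symm
  have hs : s ≠ 0 := by rintro rfl; apply hxz; rw [zero_smul, sub_eq_zero] at h; exact h.symm
  by_cases hvt : v = t
  · have := cs u
    simp [Finset.sum_filter, Fin.sum_univ_three, hvt, Ne.symm hut] at this
    exact ha this
  · have := cs t
    simp [Finset.sum_filter, Fin.sum_univ_three, hvt, hut] at this
    exact hs this

lemma C5_count (hm : 5 ≤ m) : Nat.card (cycleGraph 5 →g Cay p m) ≤ p^m * (5^5 * p^5) := by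
  have hadj : ∀ (f : cycleGraph 5 →g Cay p m) (i : Fin 5), (Cay p m).Adj (f i) (f (i+1)) := by
    intro f i
    apply f.map_rel
    simp [cycleGraph_adj]
  choose st hst using fun f i => (hadj f i).2
  let enc : (cycleGraph 5 →g Cay p m) → (Fin m → ZMod p) × Zs p m 5 := fun f => (f 0, ⟨st f, by
    simp only [← hst, Fin.sum_univ_five]
    simp only [show (0:Fin 5)+1 = 1 from rfl, show (1:Fin 5)+1 = 2 from rfl, show (2:Fin 5)+1 = 3 from rfl,
      show (3:Fin 5)+1 = 4 from rfl, show (4:Fin 5)+1 = 0 from rfl]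
    abel⟩)
  have hinj : Function.Injective enc := by
    intro f g h
    have h0 : f 0 = g 0 := congrArg Prod.fst h
    have h1 : st f = st g := congrArg (fun q => q.2.1) h
    have hd : ∀ i, f i = g i → f (i+1) = g (i+1) := by
      intro i hi
      have e1 := hst f i
      have e2 := hst g i
      rw [h1, ← e2, hi] at e1
      exact sub_left_injective e1
    have h1 := hd 0 h0
    have h2 := hd 1 h1
    have h3 := hd 2 h2
    have h4 := hd 3 h3
    ext i : 1
    fin_cases i <;> assumption
  have h1 := Nat.card_le_card_of_injective enc hinj
  have h2 := card_Zs (p := p) (m := m) (k := 4) hm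
  rw [Nat.card_prod] at h1
  have h3 : Nat.card (Fin m → ZMod p) = p^m := by simp [Nat.card_fun]
  rw [h3] at h1
  exact h1.trans (Nat.mul_le_mul_left _ h2)

lemma C5p_count (hm : 4 ≤ m) : Nat.card (C5plus →g Cay p m) ≤ p^m * (4^4 * p^4) * p := by
  let q : Fin 4 → Fin 5 := ![0, 2, 3, 4]
  have hadj : ∀ (f : C5plus →g Cay p m) (i : Fin 4), (Cay p m).Adj (f (q i)) (f (q (i+1))) := by
    intro f i
    apply f.map_rel
    fin_cases i <;> simp [q, C5plus]
  choose st hst using fun f i => (hadj f i).2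
  have hline : ∀ f : C5plus →g Cay p m, ∃ s' : ZMod p, f 1 - f 0 = s' • mom p m (st f 0).2 := by
    intro f
    exact tri_line (by omega) (x := f 0) (y := f 1) (z := f 2) (f.map_rel (by simp [C5plus]))
      (f.map_rel (by simp [C5plus])) (hadj f 0).1 (st f 0) (hst f 0)
  choose s' hs' using hline
  let enc : (C5plus →g Cay p m) → ((Fin m → ZMod p) × Zs p m 4) × ZMod p := fun f => ((f 0, ⟨st f, by
    simp only [← hst, Fin.sum_univ_four]
    simp only [show (0:Fin 4)+1 = 1 from rfl, show (1:Fin 4)+1 = 2 from rfl, show (2:Fin 4)+1 = 3 from rfl,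
      show (3:Fin 4)+1 = 0 from rfl]
    abel⟩), s' f)
  have hinj : Function.Injective enc := by
    intro f g h
    have h0 : f 0 = g 0 := congrArg (fun q => q.1.1) h
    have h1 : st f = st g := congrArg (fun q => q.1.2.1) h
    have h2 : s' f = s' g := congrArg (fun q => q.2) h
    have hd : ∀ i, f (q i) = g (q i) → f (q (i+1)) = g (q (i+1)) := by
      intro i hi
      have e1 := hst f i
      have e2 := hst g i
      rw [h1, ← e2, hi] at e1
      exact sub_left_injective e1
    have k2 := hd 0 h0
    have k3 := hd 1 k2
    have k4 := hd 2 k3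
    have k1 : f 1 = g 1 := by
      have e1 := hs' f
      have e2 := hs' g
      rw [h1, h2, ← e2, h0] at e1
      exact sub_left_injective e1
    ext i : 1
    fin_cases i <;> assumption
  have h1 := Nat.card_le_card_of_injective enc hinj
  have h2 := card_Zs (p := p) (m := m) (k := 3) hm
  rw [Nat.card_prod, Nat.card_prod] at h1
  have h3 : Nat.card (Fin m → ZMod p) = p^m := by simp
  rw [h3, Nat.card_zmod] at h1
  exact h1.trans (Nat.mul_le_mul_right _ (Nat.mul_le_mul_left _ h2))

lemma C3_count (hm : 2 ≤ m) : p^m * (p * ((p-1)*(p-1) - (p-1))) ≤ Nat.card (cycleGraph 3 →g Cay p m) := by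
  classical
  let D := ((Finset.univ : Finset (ZMod p)).erase 0).offDiag
  have hD : D.card = (p-1)*(p-1) - (p-1) := by
    simp [D, Finset.offDiag_card, ZMod.card]
  have adj : ∀ (x : Fin m → ZMod p) (t a b : ZMod p), a ≠ b → (Cay p m).Adj (x + a • mom p m t) (x + b • mom p m t) := by
    intro x t a b hab
    refine ⟨?_, (b - a, t), ?_⟩
    · intro h
      have := congrFun (add_left_cancel h) ⟨0, by omega⟩
      simp [mom] at this
      exact hab this
    · simp only [sub_smul]; abel
  have adj0 : ∀ (x : Fin m → ZMod p) (t b : ZMod p), b ≠ 0 → (Cay p m).Adj x (x + b • mom p m t) := by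
    intro x t b hb
    simpa using adj x t 0 b hb.symm
  let enc : (Fin m → ZMod p) × ZMod p × D → (cycleGraph 3 →g Cay p m) := fun z =>
    (homC3 (Cay p m)).symm ⟨(z.1, z.1 + z.2.2.1.1 • mom p m z.2.1, z.1 + z.2.2.1.2 • mom p m z.2.1), by
      obtain ⟨x, t, ⟨⟨a, b⟩, hab⟩⟩ := z
      simp [D] at hab
      obtain ⟨ha, hb, hab⟩ := hab
      exact ⟨adj0 x t a ha, adj x t a b hab, (adj0 x t b hb).symm⟩⟩
  have hinj : Function.Injective enc := by
    rintro ⟨x, t, ⟨⟨a, b⟩, hab⟩⟩ ⟨x', t', ⟨⟨a', b'⟩, hab'⟩⟩ h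
    have h := congrArg Subtype.val ((homC3 (Cay p m)).symm.injective h)
    simp only [Prod.mk.injEq] at h
    obtain ⟨rfl, h1, h2⟩ := h
    have h1 := add_left_cancel h1
    have h2 := add_left_cancel h2
    have a0 := congrFun h1 ⟨0, by omega⟩
    have b0 := congrFun h2 ⟨0, by omega⟩
    have a1 := congrFun h1 ⟨1, by omega⟩
    simp only [mom, Pi.smul_apply, pow_zero, pow_one, smul_eq_mul, mul_one] at a0 b0 a1
    subst a0 b0
    simp [D] at hab
    have := mul_left_cancel₀ hab.1 a1
    subst this
    rfl
  have h1 := Nat.card_le_card_of_injective enc hinj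
  rw [Nat.card_prod, Nat.card_prod, Nat.card_zmod] at h1
  have h3 : Nat.card (Fin m → ZMod p) = p^m := by simp
  rw [h3] at h1
  have h4 : Nat.card D = (p-1)*(p-1) - (p-1) := by
    rw [← hD]; simp
  rwa [h4] at h1
end constr

/-- asymptotic comparison -/
lemma asym (c a D K : ℝ) (hK : 0 < K)
    (h : ∀ p : ℕ, p.Prime → 3 ≤ p → ((p:ℝ)^(-a) / 8) ^ c ≤ K * (p:ℝ)^(-D)) : D ≤ a * c := by
  by_contra! hlt
  set B := Real.log K + c * Real.log 8
  obtain ⟨p, hp, hpp⟩ := Nat.exists_infinite_primes (⌈Real.exp (B / (D - a*c) + 1)⌉₊ + 3)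
  have hp0 : (0:ℝ) < p := by exact_mod_cast hpp.pos
  have h1 := h p hpp (by omega)
  have h2 := Real.log_le_log (by positivity) h1
  rw [Real.log_rpow (by positivity), Real.log_div (by positivity) (by norm_num), Real.log_rpow hp0,
    Real.log_mul (by positivity) (by positivity), Real.log_rpow hp0] at h2
  have h3 : Real.exp (B / (D - a*c) + 1) ≤ p := by
    refine (Nat.le_ceil _).trans ?_
    exact_mod_cast (by omega)
  have h4 : B / (D - a*c) + 1 ≤ Real.log p := (Real.le_log_iff_exp_le hp0).2 h3
  have hd : 0 < D - a * c := by linarith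
  have h5 : B / (D - a*c) < Real.log p := by linarith
  rw [div_lt_iff₀ hd] at h5
  simp only [B] at h5
  nlinarith

lemma lower_gen {α : Type*} [Fintype α] (G : SimpleGraph α) (m e K : ℕ) (hα : Fintype.card α = 5)
    (hm : 3 ≤ m) (hK : 0 < K)
    (hG : ∀ p : ℕ, p.Prime → Nat.card (G →g Cay p m) ≤ K * p ^ e) (c : ℝ)
    (hc : c ∈ domSet G (cycleGraph 3)) : (5 * m - e : ℝ) ≤ (2 * m - 3) * c := by
  refine asym c _ _ K (by exact_mod_cast hK) ?_
  intro p hp h3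
  haveI : Fact p.Prime := ⟨hp⟩
  have hp0 : (0:ℝ) < p := by exact_mod_cast hp.pos
  have h := domSet_apply G (cycleGraph 3) (Cay p m) hc
  have hV : Fintype.card (Fin m → ZMod p) = p ^ m := by simp [ZMod.card]
  have u : homDensity G (Cay p m) ≤ K * (p:ℝ) ^ (-(5 * m - e : ℝ)) := by
    unfold homDensity
    rw [hV, hα, div_le_iff₀ (by positivity)]
    have h1 : (Nat.card (G →g Cay p m) : ℝ) ≤ K * (p:ℝ) ^ e := by exact_mod_cast hG p hp
    refine h1.trans (le_of_eq ?_)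
    push_cast
    rw [mul_assoc]
    congr 1
    rw [← pow_mul, ← Real.rpow_natCast, ← Real.rpow_natCast, ← Real.rpow_add hp0]
    congr 1
    push_cast
    ring
  have l : (p:ℝ) ^ (-(2 * m - 3 : ℝ)) / 8 ≤ homDensity (cycleGraph 3) (Cay p m) := by
    unfold homDensity
    rw [hV, Fintype.card_fin, le_div_iff₀ (by positivity)]
    have h1 := C3_count (p := p) (m := m) (by omega)
    have h2 : (p:ℝ)^m * (p * (p^2 / 8)) ≤ Nat.card (cycleGraph 3 →g Cay p m) := by
      refine le_trans ?_ (Nat.cast_le.2 h1)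
      obtain ⟨k, rfl⟩ : ∃ k, p = k + 3 := ⟨p - 3, by omega⟩
      have e1 : (k + 3 - 1) * (k + 3 - 1) - (k + 3 - 1) = (k+2)*(k+1) := by
        rw [show k + 3 - 1 = k + 2 by omega]
        have : (k+2)*(k+2) = (k+2)*(k+1) + (k+2) := by ring
        omega
      rw [e1]
      push_cast
      gcongr
      have : (0:ℝ) ≤ k := Nat.cast_nonneg k
      nlinarith
    refine le_trans (le_of_eq ?_) h2
    push_cast
    have e1 : (p:ℝ) ^ (-(2 * m - 3 : ℝ)) * ((p:ℝ)^m)^3 = p^m * (p * p^2) := by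
      rw [← pow_mul, ← pow_succ', ← pow_add, ← Real.rpow_natCast, ← Real.rpow_natCast, ← Real.rpow_add hp0]
      congr 1
      push_cast
      ring
    linear_combination e1 / 8
  exact (Real.rpow_le_rpow (by positivity) l hc.1).trans (h.trans u)

open Classical in
noncomputable def adjR {V : Type*} (T : SimpleGraph V) (x y : V) : ℝ := if T.Adj x y then 1 else 0

lemma C3_sum {V : Type*} [Fintype V] (T : SimpleGraph V) : (Nat.card (cycleGraph 3 →g T) : ℝ) = Nt (adjR T) := by
  classical
  rw [Nat.card_congr (homC3 T), card_sub]
  simp only [Fintype.sum_prod_type, Nt, Wt, wt]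
  refine Finset.sum_congr rfl fun x _ => Finset.sum_congr rfl fun y _ => Finset.sum_congr rfl fun z _ => ?_
  unfold adjR
  split_ifs <;> simp_all

lemma C5p_sum {V : Type*} [Fintype V] (T : SimpleGraph V) : (Nat.card (C5plus →g T) : ℝ) = St (adjR T) := by
  classical
  rw [Nat.card_congr (homC5p T), card_sub]
  simp only [Fintype.sum_prod_type, St, wt, pth, cdg]
  refine Finset.sum_congr rfl fun x _ => Finset.sum_congr rfl fun y _ => ?_
  rw [Finset.sum_mul]
  refine Finset.sum_congr rfl fun z _ => ?_
  rw [Finset.mul_sum]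
  refine Finset.sum_congr rfl fun b _ => ?_
  rw [Finset.sum_mul, Finset.mul_sum]
  refine Finset.sum_congr rfl fun a _ => ?_
  unfold adjR
  by_cases h1 : T.Adj x y <;> by_cases h2 : T.Adj y z <;> by_cases h3 : T.Adj z x <;>
    by_cases h4 : T.Adj x a <;> by_cases h5 : T.Adj a b <;> by_cases h6 : T.Adj b y <;>
    simp [h1, h2, h3, h4, h5, h6]

lemma mem_C5p : (11/5 : ℝ) ∈ domSet C5plus (cycleGraph 3) := by
  refine ⟨by norm_num, fun n _ T => ?_⟩
  unfold homDensity
  rw [C3_sum, C5p_sum, Fintype.card_fin 3, Fintype.card_fin 5]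
  refine core_ineq (adjR T) (fun x y => by unfold adjR; have := T.adj_comm x y; split_ifs <;> simp_all) (fun x y => ?_)
  unfold adjR
  split_ifs <;> simp

lemma mem_C5 : (11/5 : ℝ) ∈ domSet (cycleGraph 5) (cycleGraph 3) := by
  refine ⟨by norm_num, fun n hn T => (mem_C5p.2 n hn T).trans ?_⟩
  unfold homDensity
  refine div_le_div_of_nonneg_right ?_ (by positivity)
  refine Nat.cast_le.2 (Nat.card_le_card_of_injective
    (fun f : C5plus →g T => f.comp (SimpleGraph.Hom.ofLE C5_le)) ?_)
  intro f g h
  ext x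
  have := DFunLike.congr_fun h x
  exact congrArg _ this

theorem stmt_13 :
    (15/7 : ℝ) ≤ domExp (cycleGraph 5) (cycleGraph 3) ∧
    domExp (cycleGraph 5) (cycleGraph 3) ≤ (11/5 : ℝ) ∧
    domExp C5plus (cycleGraph 3) = (11/5 : ℝ) := by
  refine ⟨?_, csInf_le ⟨0, fun c hc => hc.1⟩ mem_C5, le_antisymm (csInf_le ⟨0, fun c hc => hc.1⟩ mem_C5p) ?_⟩
  · refine le_csInf ⟨_, mem_C5⟩ fun c hc => ?_
    have := lower_gen (cycleGraph 5) 5 10 (5^5) (by simp) (by norm_num) (by norm_num) (fun p hp => by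
      haveI : Fact p.Prime := ⟨hp⟩
      exact (C5_count (p := p) (m := 5) le_rfl).trans (le_of_eq (by ring))) c hc
    norm_num at this
    linarith
  · refine le_csInf ⟨_, mem_C5p⟩ fun c hc => ?_
    have := lower_gen C5plus 4 9 (4^4) (by simp) (by norm_num) (by norm_num) (fun p hp => by
      haveI : Fact p.Prime := ⟨hp⟩
      exact (C5p_count (p := p) (m := 4) le_rfl).trans (le_of_eq (by ring))) c hc
    norm_num at this
    linarith
end
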